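/- arXiv:0906.2183 — 2 statements merged into one kernel-verified Lean document; each statement's English description precedes it below -/
import Mathlib

section
/- Let r ≥ 1, let 0 ≤ n'_1 ≤ n'_2 ≤ ⋯ ≤ n'_r be integers, and let σ be a unimodal permutation of {1,…,r}. Then φ*(n'_{σ(1)}, n'_{σ(2)}, …, n'_{σ(r)}) = φ*(n'_1, n'_2, …, n'_r). -/
/-- A pairing of the positions `Fin N`: a collection of blocks, each of size 2,
with every position in exactly one block. -/
def IsPairing {N : ℕ} (π : Finset (Finset (Fin N))) : Prop :=
  (∀ B ∈ π, B.card = 2) ∧ ∀ i : Fin N, ∃! B, B ∈ π ∧ i ∈ B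

/-- A crossing: blocks `{i₁,i₂}` and `{j₁,j₂}` with `i₁ < j₁ < i₂ < j₂`. -/
def HasCrossing {N : ℕ} (π : Finset (Finset (Fin N))) : Prop :=
  ∃ B ∈ π, ∃ C ∈ π, ∃ i₁ i₂ j₁ j₂ : Fin N,
    i₁ ∈ B ∧ i₂ ∈ B ∧ j₁ ∈ C ∧ j₂ ∈ C ∧ i₁ < j₁ ∧ j₁ < i₂ ∧ i₂ < j₂

/-- A non-crossing `w`-pairing: a non-crossing pairing of the positions of the
bitstring `w` (ones are `true`, zeros are `false`) pairing unequal letters. -/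
def IsNCPairingOn (w : List Bool) (π : Finset (Finset (Fin w.length))) : Prop :=
  IsPairing π ∧ ¬ HasCrossing π ∧
    ∀ B ∈ π, ∀ i ∈ B, ∀ j ∈ B, i ≠ j → w.get i ≠ w.get j

/-- `phi w` is the number of non-crossing `w`-pairings. -/
noncomputable def phi (w : List Bool) : ℕ :=
  Set.ncard {π : Finset (Finset (Fin w.length)) | IsNCPairingOn w π}

/-- The word `1^{n 0} 0^{m 0} 1^{n 1} 0^{m 1} ⋯ 1^{n (r-1)} 0^{m (r-1)}`. -/
def runsF {r : ℕ} (n m : Fin r → ℕ) : List Bool :=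
  (List.finRange r).flatMap fun i => List.replicate (n i) true ++ List.replicate (m i) false

/-- The word `1^{k₁} 0^{k₁} ⋯ 1^{k_r} 0^{k_r}` for `l = [k₁, …, k_r]`. -/
def symWord (l : List ℕ) : List Bool :=
  l.flatMap fun k => List.replicate k true ++ List.replicate k false

/-- The symmetrized pairing function `φ*(n₁,…,n_r) = φ(1^{n₁}0^{n₁}⋯1^{n_r}0^{n_r})`. -/
noncomputable def phiStar (l : List ℕ) : ℕ := phi (symWord l)

/-- `Yval w i` is the lattice-path value `Y_i`. -/
def Yval (w : List Bool) (i : ℕ) : ℤ :=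
  ((w.take i).count true : ℤ) - ((w.take i).count false : ℤ)

/-- The height of position `i` of `w`, relative to the minimum `mY` of the `Y_i`. -/
def heightAt (w : List Bool) (mY : ℤ) (i : Fin w.length) : ℤ :=
  if w.get i then Yval w (i.val + 1) - mY else Yval w (i.val + 1) - mY + 1

/-- `d : Fin r → ℕ` is a Catalan degree sequence of order `r`. -/
def IsCatalanSeq (r : ℕ) (d : Fin r → ℕ) : Prop :=
  (∀ i : ℕ, 1 ≤ i → i ≤ r - 1 →
      (i : ℕ) ≤ ∑ j ∈ Finset.univ.filter (fun j : Fin r => (j : ℕ) < i), d j) ∧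
  ∑ j, d j = r - 1

/-- Sum of the first `j` values of `f`. -/
def prefSum {r : ℕ} (f : Fin r → ℕ) (j : ℕ) : ℕ :=
  ∑ i ∈ Finset.univ.filter (fun i : Fin r => (i : ℕ) < j), f i

/-- `m` is a member of `CF(n)`. -/
def InCF {r : ℕ} (n m : Fin r → ℕ) : Prop :=
  (∀ j : ℕ, 1 ≤ j → j ≤ r - 1 → prefSum m j ≤ prefSum n j) ∧
  (∑ i, m i = ∑ i, n i)

/-- Non-crossing fixed-point-free involutions of `[a, b)` matching unequal values of `S`,
extended by the identity to all of `ℕ`. -/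
def IsNCInvolution (S : ℕ → Bool) (a b : ℕ) (f : ℕ → ℕ) : Prop :=
  (∀ i, f (f i) = i) ∧ (∀ i, ¬(a ≤ i ∧ i < b) → f i = i) ∧
    (∀ i, a ≤ i → i < b → S (f i) ≠ S i) ∧
    ∀ i j, i < j → j < f i → f i < f j → False

namespace IsNCInvolution

variable {S : ℕ → Bool} {a b : ℕ} {f : ℕ → ℕ}

lemma ne_self (h : IsNCInvolution S a b f) {i : ℕ} (h₁ : a ≤ i) (h₂ : i < b) : f i ≠ i :=
  fun e => h.2.2.1 i h₁ h₂ (by rw [e])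

lemma mapsTo (h : IsNCInvolution S a b f) {i : ℕ} (h₁ : a ≤ i) (h₂ : i < b) :
    a ≤ f i ∧ f i < b := by
  by_contra hc
  have h₃ := h.2.1 _ hc
  rw [h.1] at h₃
  exact h.ne_self h₁ h₂ h₃.symm

lemma finite_setOf (S : ℕ → Bool) (a b : ℕ) : {f | IsNCInvolution S a b f}.Finite := by
  have key : ∀ f, IsNCInvolution S a b f → ∀ i : Fin b, f i < b := by
    intro f hf i
    by_cases hi : a ≤ (i : ℕ)
    · exact (hf.mapsTo hi i.2).2
    · rw [hf.2.1 i (fun h => hi h.1)]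
      exact i.2
  refine Set.Finite.of_injOn (f := fun f : ℕ → ℕ => fun i : Fin b => f i)
    (t := Set.pi Set.univ fun _ => Set.Iio b) ?_ ?_ (Set.Finite.pi fun _ => Set.finite_Iio b)
  · intro f hf i _
    exact key f hf i
  · intro f hf g hg hfg
    funext i
    by_cases hi : i < b
    · exact congrFun hfg ⟨i, hi⟩
    · rw [hf.2.1 i (fun h => hi h.2), hg.2.1 i (fun h => hi h.2)]

end IsNCInvolution

/-- The finite set of non-crossing involutions of `[a, b)`. -/
noncomputable def ncInvolutions (S : ℕ → Bool) (a b : ℕ) : Finset (ℕ → ℕ) :=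
  (IsNCInvolution.finite_setOf S a b).toFinset

lemma mem_ncInvolutions {S : ℕ → Bool} {a b : ℕ} {f : ℕ → ℕ} :
    f ∈ ncInvolutions S a b ↔ IsNCInvolution S a b f := by
  simp [ncInvolutions]

lemma ncInvolutions_self (S : ℕ → Bool) (a : ℕ) : (ncInvolutions S a a).card = 1 := by
  rw [Finset.card_eq_one]
  refine ⟨id, ?_⟩
  ext f
  rw [mem_ncInvolutions, Finset.mem_singleton]
  constructor
  · intro h
    funext i
    exact h.2.1 i (by omega)
  · rintro rfl
    refine ⟨fun _ => rfl, fun _ _ => rfl, fun i _ _ => by omega, fun i j _ _ _ => ?_⟩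
    simp only [id] at *
    omega

/-- Glue involutions of `(a, k)` and `(k, b)` along the arc `{a, k}`. -/
def glueArc (a k : ℕ) (p : (ℕ → ℕ) × (ℕ → ℕ)) (i : ℕ) : ℕ :=
  if i = a then k else if i = k then a else if i < k then p.1 i else p.2 i

lemma card_ncInvolutions_fiber {S : ℕ → Bool} {a b k : ℕ} (hak : a < k) (hkb : k < b)
    (hS : S a ≠ S k) :
    ((ncInvolutions S a b).filter (fun f => f a = k)).card =
      (ncInvolutions S (a + 1) k).card * (ncInvolutions S (k + 1) b).card := by
  rw [← Finset.card_product]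
  symm
  refine Finset.card_nbij' (glueArc a k)
    (fun f => (fun i => if a < i ∧ i < k then f i else i, fun i => if k < i then f i else i))
    ?_ ?_ ?_ ?_
  · rintro ⟨f, g⟩ hp
    simp only [Finset.coe_product, Set.mem_prod, Finset.mem_coe, mem_ncInvolutions] at hp
    obtain ⟨hf, hg⟩ := hp
    simp only [Finset.coe_filter, Set.mem_ofPred_eq, mem_ncInvolutions]
    have f1 : ∀ i, a < i → i < k → a < f i ∧ f i < k := fun i h₁ h₂ => hf.mapsTo h₁ h₂
    have g1 : ∀ i, k < i → i < b → k < g i ∧ g i < b := fun i h₁ h₂ => hg.mapsTo h₁ h₂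
    have f2 : ∀ i, i < a → f i = i := fun i h₁ => hf.2.1 i (by omega)
    have g2 : ∀ i, b ≤ i → g i = i := fun i h₁ => hg.2.1 i (by omega)
    have f0 := hf.1
    have g0 := hg.1
    have f3 := hf.2.2.1
    have g3 := hg.2.2.1
    have f4 := hf.2.2.2
    have g4 := hg.2.2.2
    have ea : glueArc a k (f, g) a = k := by simp [glueArc]
    have ek : glueArc a k (f, g) k = a := by simp [glueArc]
    have ein : ∀ i, a < i → i < k → glueArc a k (f, g) i = f i := fun i h₁ h₂ => by
      rw [glueArc, if_neg (by omega), if_neg (by omega), if_pos h₂]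
    have eout : ∀ i, k < i → glueArc a k (f, g) i = g i := fun i h₁ => by
      rw [glueArc, if_neg (by omega), if_neg (by omega), if_neg (by omega)]
    have elow : ∀ i, i < a → glueArc a k (f, g) i = i := fun i h₁ => by
      rw [glueArc, if_neg (by omega), if_neg (by omega), if_pos (by omega)]
      exact f2 i h₁
    have g5 : ∀ i, k < i → k < g i := fun i h₁ => by
      rcases lt_or_ge i b with h | h
      · exact (g1 i h₁ h).1
      · rwa [g2 i h]
    have tri : ∀ i, i < a ∨ i = a ∨ (a < i ∧ i < k) ∨ i = k ∨ k < i := fun i => by omega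
    refine ⟨⟨?_, ?_, ?_, ?_⟩, ea⟩
    · intro i
      rcases tri i with h | rfl | h | rfl | h
      · rw [elow i h, elow i h]
      · rw [ea, ek]
      · have := f1 i h.1 h.2
        rw [ein i h.1 h.2, ein _ this.1 this.2, f0]
      · rw [ek, ea]
      · rw [eout i h, eout _ (g5 i h), g0]
    · intro i hi
      rcases lt_or_ge i a with h | h
      · exact elow i h
      · rw [eout i (by omega), g2 i (by omega)]
    · intro i h₁ h₂
      rcases tri i with h | rfl | h | rfl | h
      · omega
      · rw [ea]; exact hS.symm
      · rw [ein i h.1 h.2]; exact f3 i h.1 h.2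
      · rw [ek]; exact hS
      · rw [eout i h]; exact g3 i h h₂
    · intro i j h₁ h₂ h₃
      rcases tri i with h | rfl | h | rfl | h
      · rw [elow i h] at h₂; omega
      · rw [ea] at h₂ h₃
        have := f1 j h₁ h₂
        rw [ein j h₁ h₂] at h₃
        omega
      · have := f1 i h.1 h.2
        rw [ein i h.1 h.2] at h₂ h₃
        rw [ein j (by omega) (by omega)] at h₃
        exact f4 i j h₁ h₂ h₃
      · rw [ek] at h₂; omega
      · rw [eout i h] at h₂ h₃
        rw [eout j (by omega)] at h₃
        exact g4 i j h₁ h₂ h₃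
  · intro f hf
    simp only [Finset.coe_filter, Set.mem_ofPred_eq, mem_ncInvolutions] at hf
    obtain ⟨hf, hk⟩ := hf
    simp only [Finset.coe_product, Set.mem_prod, Finset.mem_coe, mem_ncInvolutions]
    have f0 := hf.1
    have f1 := fun i => @IsNCInvolution.mapsTo _ _ _ _ hf i
    have f2 := hf.2.1
    have f3 := hf.2.2.1
    have f4 := hf.2.2.2
    have hka : f k = a := by rw [← hk, f0]
    have hkb' := f1 a le_rfl (by omega)
    have inner : ∀ i, a < i → i < k → a < f i ∧ f i < k := by
      intro i h₁ h₂
      have := f1 i (by omega) (by omega)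
      have : ¬ f a < f i := f4 a i h₁ (by omega)
      have : f i ≠ a := fun e => by have := f0 i; rw [e] at this; omega
      have : f i ≠ k := fun e => by have := f0 i; rw [e] at this; omega
      omega
    have outer : ∀ i, k < i → k < f i := by
      intro i h₁
      by_contra hc
      by_cases hb : i < b
      · have := f1 i (by omega) (by omega)
        have : f i ≠ a := fun e => by have := f0 i; rw [e] at this; omega
        have : f i ≠ k := fun e => by have := f0 i; rw [e] at this; omega
        have h₂ := inner (f i) (by omega) (by omega)
        rw [f0] at h₂
        omega
      · have := f2 i (by omega)
        omega
    refine ⟨⟨?_, ?_, ?_, ?_⟩, ⟨?_, ?_, ?_, ?_⟩⟩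
    · intro i; grind
    · intro i hi; grind
    · intro i h₁ h₂; grind
    · intro i j h₁ h₂ h₃; grind
    · intro i; grind
    · intro i hi; grind
    · intro i h₁ h₂; grind
    · intro i j h₁ h₂ h₃; grind
  · rintro ⟨f, g⟩ hp
    simp only [Finset.coe_product, Set.mem_prod, Finset.mem_coe, mem_ncInvolutions] at hp
    obtain ⟨hf, hg⟩ := hp
    have f2 := hf.2.1
    have g2 := hg.2.1
    simp only [Prod.mk.injEq]
    constructor <;> funext i <;> simp only [glueArc] <;> grind
  · intro f hf
    simp only [Finset.coe_filter, Set.mem_ofPred_eq, mem_ncInvolutions] at hf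
    obtain ⟨hf, hk⟩ := hf
    have f0 := hf.1
    have f2 := hf.2.1
    have hka : f k = a := by rw [← hk, f0]
    funext i
    simp only [glueArc]
    grind

lemma card_ncInvolutions_succ (S : ℕ → Bool) (a n : ℕ) :
    (ncInvolutions S a (a + 1 + n)).card = ∑ i ∈ Finset.range n,
      if S (a + 1 + i) ≠ S a then
        (ncInvolutions S (a + 1) (a + 1 + i)).card *
          (ncInvolutions S (a + 1 + i + 1) (a + 1 + n)).card
      else 0 := by
  have hmaps : ∀ f ∈ ncInvolutions S a (a + 1 + n),
      f a ∈ (Finset.range n).image (fun i => a + 1 + i) := by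
    intro f hf
    rw [mem_ncInvolutions] at hf
    have h₁ := hf.mapsTo le_rfl (by omega)
    have h₂ := hf.ne_self le_rfl (by omega)
    rw [Finset.mem_image]
    exact ⟨f a - (a + 1), by rw [Finset.mem_range]; omega, by omega⟩
  rw [Finset.card_eq_sum_card_fiberwise hmaps,
    Finset.sum_image (fun i _ j _ h => by simpa using h)]
  refine Finset.sum_congr rfl fun i hi => ?_
  rw [Finset.mem_range] at hi
  split_ifs with hS
  · exact card_ncInvolutions_fiber (by omega) (by omega) hS.symm
  · rw [Finset.card_eq_zero, Finset.filter_eq_empty_iff]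
    intro f hf e
    rw [mem_ncInvolutions] at hf
    have := hf.2.2.1 a le_rfl (by omega)
    rw [e] at this
    exact hS this

lemma card_ncInvolutions_congr {S T : ℕ → Bool} (n : ℕ) : ∀ {a b : ℕ},
    (∀ i < n, S (a + i) = T (b + i)) →
      (ncInvolutions S a (a + n)).card = (ncInvolutions T b (b + n)).card := by
  induction n using Nat.strong_induction_on with
  | _ n ih =>
    intro a b h
    cases n with
    | zero => simp [ncInvolutions_self]
    | succ n =>
      rw [Nat.add_comm n 1, ← Nat.add_assoc, ← Nat.add_assoc, card_ncInvolutions_succ,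
        card_ncInvolutions_succ]
      refine Finset.sum_congr rfl fun i hi => ?_
      rw [Finset.mem_range] at hi
      have h₀ := h 0 (by omega)
      have h₁ := h (1 + i) (by omega)
      have h₂ := ih i (by omega) (a := a + 1) (b := b + 1) fun j hj => by
        simpa [Nat.add_assoc] using h (1 + j) (by omega)
      have h₃ := ih (n - i - 1) (by omega) (a := a + 1 + i + 1) (b := b + 1 + i + 1)
        fun j hj => by simpa [Nat.add_assoc] using h (1 + (i + (1 + j))) (by omega)
      rw [show a + 1 + i + 1 + (n - i - 1) = a + 1 + n by omega,
        show b + 1 + i + 1 + (n - i - 1) = b + 1 + n by omega] at h₃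
      simp only [Nat.add_zero, ← Nat.add_assoc] at h₀ h₁
      rw [h₀, h₁, h₂, h₃]

/-- The pairing whose blocks are the orbits of `f`. -/
def orbitPairing {N : ℕ} (f : ℕ → ℕ) : Finset (Finset (Fin N)) :=
  Finset.univ.filter fun B => ∃ i j : Fin N, f i = j ∧ B = {i, j}

lemma phi_eq_card (w : List Bool) :
    phi w = (ncInvolutions (fun i => w.getD i false) 0 w.length).card := by
  classical
  have hget : ∀ i : Fin w.length, w.getD i false = w.get i := fun i => by simp
  rw [phi, ← Set.ncard_coe_finset]
  symm
  refine Set.ncard_congr (fun f _ => orbitPairing f) ?_ ?_ ?_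
  · intro f hf
    rw [Finset.mem_coe, mem_ncInvolutions] at hf
    have hlt : ∀ i : Fin w.length, f i < w.length := fun i => (hf.mapsTo (Nat.zero_le _) i.2).2
    have hne : ∀ i : Fin w.length, f i ≠ i := fun i => hf.ne_self (Nat.zero_le _) i.2
    have hmem : ∀ B ∈ orbitPairing (N := w.length) f, ∀ i ∈ B, ∀ j ∈ B, i ≠ j → f i = j := by
      intro B hB i hi j hj hij
      simp only [orbitPairing, Finset.mem_filter, Finset.mem_univ, true_and] at hB
      obtain ⟨x, y, hxy, rfl⟩ := hB
      have hyx : f y = x := by rw [← hxy, hf.1]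
      simp only [Finset.mem_insert, Finset.mem_singleton] at hi hj
      rcases hi with rfl | rfl <;> rcases hj with rfl | rfl
      · exact absurd rfl hij
      · exact hxy
      · exact hyx
      · exact absurd rfl hij
    refine ⟨⟨?_, ?_⟩, ?_, ?_⟩
    · intro B hB
      simp only [orbitPairing, Finset.mem_filter, Finset.mem_univ, true_and] at hB
      obtain ⟨x, y, hxy, rfl⟩ := hB
      refine Finset.card_pair fun h => hne x ?_
      rw [hxy, h]
    · intro i
      refine ⟨{i, ⟨f i, hlt i⟩}, ⟨?_, by simp⟩, ?_⟩
      · simp only [orbitPairing, Finset.mem_filter, Finset.mem_univ, true_and]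
        exact ⟨i, ⟨f i, hlt i⟩, rfl, rfl⟩
      · rintro B ⟨hB, hi⟩
        simp only [orbitPairing, Finset.mem_filter, Finset.mem_univ, true_and] at hB
        obtain ⟨x, y, hxy, rfl⟩ := hB
        have hyx : f y = x := by rw [← hxy, hf.1]
        simp only [Finset.mem_insert, Finset.mem_singleton] at hi
        rcases hi with rfl | rfl
        · congr
          exact Fin.ext hxy.symm
        · rw [Finset.pair_comm]
          congr
          exact Fin.ext hyx.symm
    · rintro ⟨B, hB, C, hC, i₁, i₂, j₁, j₂, hi₁, hi₂, hj₁, hj₂, h₁, h₂, h₃⟩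
      have e₁ := hmem B hB i₁ hi₁ i₂ hi₂ (h₁.trans h₂).ne
      have e₂ := hmem C hC j₁ hj₁ j₂ hj₂ (h₂.trans h₃).ne
      refine hf.2.2.2 i₁ j₁ h₁ ?_ ?_
      · rw [e₁]; exact h₂
      · rw [e₁, e₂]; exact h₃
    · intro B hB i hi j hj hij
      have e := hmem B hB i hi j hj hij
      rw [← hget, ← hget, ← e]
      exact (hf.2.2.1 i (Nat.zero_le _) i.2).symm
  · intro f g hf hg hfg
    rw [Finset.mem_coe, mem_ncInvolutions] at hf hg
    funext i
    by_cases hi : i < w.length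
    · have hfi := (hf.mapsTo (Nat.zero_le _) hi).2
      have hB : ({⟨i, hi⟩, ⟨f i, hfi⟩} : Finset (Fin w.length)) ∈ orbitPairing f := by
        simp only [orbitPairing, Finset.mem_filter, Finset.mem_univ, true_and]
        exact ⟨⟨i, hi⟩, ⟨f i, hfi⟩, rfl, rfl⟩
      rw [hfg] at hB
      simp only [orbitPairing, Finset.mem_filter, Finset.mem_univ, true_and] at hB
      obtain ⟨x, y, hxy, he⟩ := hB
      have hyx : g y = x := by rw [← hxy, hg.1]
      have hne : f i ≠ i := hf.ne_self (Nat.zero_le _) hi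
      have h₁ : (⟨i, hi⟩ : Fin w.length) ∈ ({x, y} : Finset (Fin w.length)) := by
        rw [← he]; simp
      have h₂ : (⟨f i, hfi⟩ : Fin w.length) ∈ ({x, y} : Finset (Fin w.length)) := by
        rw [← he]; simp
      simp only [Finset.mem_insert, Finset.mem_singleton, Fin.ext_iff] at h₁ h₂
      rcases h₁ with h₁ | h₁ <;> rcases h₂ with h₂ | h₂
      · omega
      · rw [h₂, h₁, hxy]
      · rw [h₂, h₁, hyx]
      · omega
    · rw [hf.2.1 i (fun h => hi h.2), hg.2.1 i (fun h => hi h.2)]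
  · rintro π ⟨⟨hcard, huniq⟩, hcross, hS⟩
    have hpartner : ∀ i : Fin w.length, ∃ j, j ≠ i ∧ ({i, j} : Finset (Fin w.length)) ∈ π := by
      intro i
      obtain ⟨B, ⟨hB, hi⟩, -⟩ := huniq i
      obtain ⟨x, y, hxy, rfl⟩ := Finset.card_eq_two.mp (hcard B hB)
      simp only [Finset.mem_insert, Finset.mem_singleton] at hi
      rcases hi with rfl | rfl
      · exact ⟨y, hxy.symm, hB⟩
      · exact ⟨x, hxy, by rwa [Finset.pair_comm]⟩
    choose p hpne hpmem using hpartner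
    have hp_eq : ∀ i j : Fin w.length, i ≠ j → {i, j} ∈ π → p i = j := by
      intro i j hij hmem
      have h := (huniq i).unique ⟨hpmem i, by simp⟩ ⟨hmem, by simp⟩
      have h' : p i ∈ ({i, j} : Finset (Fin w.length)) := by rw [← h]; simp
      simp only [Finset.mem_insert, Finset.mem_singleton] at h'
      exact h'.resolve_left (hpne i)
    have hpp : ∀ i, p (p i) = i := fun i =>
      hp_eq _ _ (hpne i) (by rw [Finset.pair_comm]; exact hpmem i)
    let f : ℕ → ℕ := fun i => if h : i < w.length then p ⟨i, h⟩ else i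
    have hf : ∀ i : Fin w.length, f i = p i := fun i => by simp [f]
    have hf' : ∀ i, ¬ i < w.length → f i = i := fun i hi => by simp [f, hi]
    refine ⟨f, ?_, ?_⟩
    · rw [Finset.mem_coe, mem_ncInvolutions]
      refine ⟨?_, ?_, ?_, ?_⟩
      · intro i
        by_cases hi : i < w.length
        · rw [hf ⟨i, hi⟩, hf, hpp]
        · rw [hf' i hi, hf' i hi]
      · intro i hi
        exact hf' i (by omega)
      · intro i _ hi
        rw [hf ⟨i, hi⟩]
        change w.getD (p ⟨i, hi⟩) false ≠ w.getD (⟨i, hi⟩ : Fin w.length) false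
        rw [hget, hget]
        exact hS _ (hpmem ⟨i, hi⟩) _ (by simp) _ (by simp) (hpne _)
      · intro i j h₁ h₂ h₃
        have hi : i < w.length := by
          by_contra hi
          rw [hf' i hi] at h₂
          omega
        rw [hf ⟨i, hi⟩] at h₂ h₃
        have hj : j < w.length := h₂.trans (p ⟨i, hi⟩).2
        rw [hf ⟨j, hj⟩] at h₃
        exact hcross ⟨_, hpmem ⟨i, hi⟩, _, hpmem ⟨j, hj⟩, ⟨i, hi⟩, p ⟨i, hi⟩, ⟨j, hj⟩,
          p ⟨j, hj⟩, by simp, by simp, by simp, by simp, h₁, h₂, h₃⟩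
    · ext B
      simp only [orbitPairing, Finset.mem_filter, Finset.mem_univ, true_and]
      constructor
      · rintro ⟨i, j, hij, rfl⟩
        rw [hf, Fin.val_inj] at hij
        rw [← hij]
        exact hpmem i
      · intro hB
        obtain ⟨x, y, hxy, rfl⟩ := Finset.card_eq_two.mp (hcard B hB)
        exact ⟨x, y, by rw [hf, hp_eq x y hxy hB], rfl⟩

lemma phi_nil : phi [] = 1 := by
  rw [phi_eq_card, List.length_nil, ncInvolutions_self]

lemma phi_cons_eq_sum (x : Bool) (w : List Bool) :
    phi (x :: w) = ∑ i ∈ Finset.range w.length,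
      if w.getD i false ≠ x then phi (w.take i) * phi (w.drop (i + 1)) else 0 := by
  rw [phi_eq_card, List.length_cons, ← Nat.zero_add (w.length + 1), Nat.add_comm w.length 1,
    ← Nat.add_assoc, card_ncInvolutions_succ]
  refine Finset.sum_congr rfl fun i hi => ?_
  rw [Finset.mem_range] at hi
  have h₁ : (ncInvolutions (fun i => (x :: w).getD i false) (0 + 1) (0 + 1 + i)).card =
      phi (w.take i) := by
    rw [phi_eq_card, List.length_take, min_eq_left hi.le]
    have h := card_ncInvolutions_congr (S := fun i => (x :: w).getD i false)
      (T := fun j => (w.take i).getD j false) i (a := 0 + 1) (b := 0) (by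
        intro j hj
        simp [hj, Nat.add_comm])
    rwa [Nat.zero_add i] at h
  have h₂ : (ncInvolutions (fun i => (x :: w).getD i false) (0 + 1 + i + 1)
      (0 + 1 + w.length)).card = phi (w.drop (i + 1)) := by
    rw [phi_eq_card, List.length_drop]
    have h := card_ncInvolutions_congr (S := fun i => (x :: w).getD i false)
      (T := fun j => (w.drop (i + 1)).getD j false) (w.length - (i + 1))
      (a := 0 + 1 + i + 1) (b := 0) (by
        intro j hj
        rw [show 0 + 1 + i + 1 + j = (i + 1 + j) + 1 by omega]
        simp [List.getElem?_drop])
    rwa [Nat.zero_add (w.length - (i + 1)),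
      show 0 + 1 + i + 1 + (w.length - (i + 1)) = 0 + 1 + w.length by omega] at h
  rw [h₁, h₂]
  simp [Nat.add_comm 1 i]

/-- The sum of `F u * G v` over all decompositions `w = u ++ y :: v` with `y ≠ x`. -/
def arcSum (x : Bool) : (List Bool → ℕ) → (List Bool → ℕ) → List Bool → ℕ
  | _, _, [] => 0
  | F, G, y :: w => (if y ≠ x then F [] * G w else 0) + arcSum x (fun u => F (y :: u)) G w

lemma arcSum_eq_sum (x : Bool) (w : List Bool) : ∀ F G : List Bool → ℕ,
    arcSum x F G w = ∑ i ∈ Finset.range w.length,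
      if w.getD i false ≠ x then F (w.take i) * G (w.drop (i + 1)) else 0 := by
  induction w with
  | nil => intro F G; simp [arcSum]
  | cons y w ih =>
    intro F G
    rw [List.length_cons, Finset.sum_range_succ', arcSum, ih, Nat.add_comm]
    simp

lemma arcSum_append (x : Bool) (u v : List Bool) : ∀ F G : List Bool → ℕ,
    arcSum x F G (u ++ v) =
      arcSum x F (fun s => G (s ++ v)) u + arcSum x (fun s => F (u ++ s)) G v := by
  induction u with
  | nil => intro F G; simp [arcSum]
  | cons y u ih => intro F G; simp [arcSum, ih, Nat.add_assoc]

lemma arcSum_congr (x : Bool) {G G' : List Bool → ℕ} (w : List Bool)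
    (h : ∀ s : List Bool, s.length < w.length → G s = G' s) :
    ∀ F : List Bool → ℕ, arcSum x F G w = arcSum x F G' w := by
  induction w with
  | nil => intro F; rfl
  | cons y w ih =>
    intro F
    rw [arcSum, arcSum, h w (by simp), ih fun s hs => h s (by simp; omega)]

lemma arcSum_add_left (x : Bool) (H : List Bool → ℕ) (w : List Bool) : ∀ F G : List Bool → ℕ,
    arcSum x (fun s => F s + G s) H w = arcSum x F H w + arcSum x G H w := by
  induction w with
  | nil => intro F G; rfl
  | cons y w ih =>
    intro F G
    simp only [arcSum, ih]
    split_ifs <;> ring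

lemma arcSum_mul_left (x : Bool) (H : List Bool → ℕ) (c : ℕ) (w : List Bool) :
    ∀ F : List Bool → ℕ, arcSum x (fun s => c * F s) H w = c * arcSum x F H w := by
  induction w with
  | nil => intro F; rfl
  | cons y w ih =>
    intro F
    simp only [arcSum, ih]
    split_ifs <;> ring

lemma arcSum_assoc (x z : Bool) (G H : List Bool → ℕ) (w : List Bool) : ∀ F : List Bool → ℕ,
    arcSum z F (arcSum x G H) w = arcSum x (arcSum z F G) H w := by
  induction w with
  | nil => intro F; rfl
  | cons y w ih =>
    intro F
    have h : (fun u => arcSum z F G (y :: u)) =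
        fun u => (if y ≠ z then F [] else 0) * G u + arcSum z (fun s => F (y :: s)) G u := by
      funext u
      simp only [arcSum]
      split_ifs <;> ring
    rw [arcSum, ih]
    conv_rhs => rw [arcSum, h, arcSum_add_left, arcSum_mul_left]
    simp only [arcSum]
    split_ifs <;> ring

lemma phi_cons (x : Bool) (w : List Bool) : phi (x :: w) = arcSum x phi phi w := by
  rw [phi_cons_eq_sum, arcSum_eq_sum]

lemma phi_append_singleton (x : Bool) (w : List Bool) : phi (w ++ [x]) = arcSum x phi phi w := by
  induction hn : w.length using Nat.strong_induction_on generalizing w with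
  | _ n ih =>
    cases w with
    | nil => simp [phi_cons, arcSum]
    | cons z w =>
      subst hn
      have h₁ : arcSum z phi (fun s => phi (s ++ [x])) w =
          arcSum z phi (arcSum x phi phi) w :=
        arcSum_congr z w (fun s hs => ih s.length (by simp; omega) s rfl) phi
      have h₂ : (fun u => phi (z :: u)) = arcSum z phi phi := funext fun u => phi_cons z u
      rw [List.cons_append, phi_cons, arcSum_append, h₁, arcSum_assoc]
      conv_rhs => rw [arcSum, h₂]
      simp only [arcSum, phi_nil, List.append_nil]
      rcases eq_or_ne x z with h | h
      · simp [h]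
      · simp [h, h.symm, Nat.add_comm]

/-- `phi` is invariant under cyclic rotations. -/
lemma phi_append_comm (u v : List Bool) : phi (u ++ v) = phi (v ++ u) := by
  induction u generalizing v with
  | nil => simp
  | cons x u ih =>
    rw [List.cons_append, phi_cons, ← phi_append_singleton, List.append_assoc, ih]
    simp

lemma exists_of_arcSum_ne_zero (x : Bool) {G : List Bool → ℕ} (w : List Bool) :
    ∀ F : List Bool → ℕ, arcSum x F G w ≠ 0 → ∃ u y v, w = u ++ y :: v ∧ y ≠ x ∧
      F u ≠ 0 ∧ G v ≠ 0 := by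
  induction w with
  | nil => intro F h; exact absurd rfl h
  | cons y w ih =>
    intro F h
    by_cases h₁ : arcSum x (fun u => F (y :: u)) G w = 0
    · rw [arcSum, h₁] at h
      refine ⟨[], y, w, rfl, ?_⟩
      by_cases hy : y = x
      · simp [hy] at h
      · simp [hy] at h
        exact ⟨hy, h⟩
    · obtain ⟨u, y', v, rfl, h₂⟩ := ih _ h₁
      exact ⟨y :: u, y', v, rfl, h₂⟩

lemma count_eq_of_phi_ne_zero (w : List Bool) (h : phi w ≠ 0) :
    w.count true = w.count false := by
  induction hn : w.length using Nat.strong_induction_on generalizing w with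
  | _ n ih =>
    cases w with
    | nil => rfl
    | cons x w =>
      rw [phi_cons] at h
      obtain ⟨u, y, v, rfl, hy, hu, hv⟩ := exists_of_arcSum_ne_zero x w _ h
      have h₁ := ih u.length (by
        rw [← hn, List.length_cons, List.length_append, List.length_cons]
        omega) u hu rfl
      have h₂ := ih v.length (by
        rw [← hn, List.length_cons, List.length_append, List.length_cons]
        omega) v hv rfl
      cases x <;> cases y <;> simp at hy ⊢
      all_goals omega

lemma phi_eq_zero {w : List Bool} (h : w.count true ≠ w.count false) : phi w = 0 := by
  by_contra hc
  exact h (count_eq_of_phi_ne_zero w hc)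

lemma arcSum_replicate_true (n : ℕ) (G : List Bool → ℕ) : ∀ F : List Bool → ℕ,
    arcSum true F G (List.replicate n true) = 0 := by
  induction n with
  | zero => intro F; rfl
  | succ n ih => intro F; simp [List.replicate_succ, arcSum, ih]

lemma arcSum_replicate_false (n : ℕ) (G : List Bool → ℕ) : ∀ F : List Bool → ℕ,
    (∀ i < n, F (List.replicate i false) = 0) →
      arcSum true F G (List.replicate n false) = 0 := by
  induction n with
  | zero => intro F _; rfl
  | succ n ih =>
    intro F h
    rw [List.replicate_succ, arcSum, ih _ fun i hi => h (i + 1) (by omega)]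
    simpa using Or.inl (h 0 (by omega))

/-- The sum of `F u * G v` over all decompositions `l = u ++ v`. -/
def listConv {α : Type*} : (List α → ℕ) → (List α → ℕ) → List α → ℕ
  | F, G, [] => F [] * G []
  | F, G, a :: l => F [] * G (a :: l) + listConv (fun u => F (a :: u)) G l

section listConv

variable {α : Type*}

lemma listConv_congr {F F' G G' : List α → ℕ} (l : List α)
    (hF : ∀ s, s ⊆ l → F s = F' s) (hG : ∀ s, s ⊆ l → G s = G' s) :
    listConv F G l = listConv F' G' l := by
  induction l generalizing F F' with
  | nil => simp [listConv, hF [] (by simp), hG [] (by simp)]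
  | cons a l ih =>
    rw [listConv, listConv, hF [] (by simp), hG _ (List.Subset.refl _)]
    congr 1
    exact ih (fun s hs => hF _ (List.cons_subset_cons a hs))
      (fun s hs => hG _ (List.subset_cons_of_subset a hs))

lemma listConv_concat (F G : List α → ℕ) (a : α) (l : List α) :
    listConv F G (l ++ [a]) =
      listConv F (fun s => G (s ++ [a])) l + F (l ++ [a]) * G [] := by
  induction l generalizing F with
  | nil => simp [listConv]
  | cons b l ih => simp [listConv, ih, Nat.add_assoc]

lemma listConv_add_left (F F' G : List α → ℕ) (l : List α) :
    listConv (fun s => F s + F' s) G l = listConv F G l + listConv F' G l := by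
  induction l generalizing F F' with
  | nil => simp only [listConv]; ring
  | cons b l ih => simp only [listConv, ih]; ring

lemma listConv_mul_left (F G : List α → ℕ) (c : ℕ) (l : List α) :
    listConv (fun s => c * F s) G l = c * listConv F G l := by
  induction l generalizing F with
  | nil => simp only [listConv]; ring
  | cons b l ih => simp only [listConv, ih]; ring

lemma listConv_assoc (F G H : List α → ℕ) (l : List α) :
    listConv (listConv F G) H l = listConv F (listConv G H) l := by
  induction l generalizing F with
  | nil => simp only [listConv]; ring
  | cons b l ih =>
    simp only [listConv, listConv_add_left, listConv_mul_left, ih]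
    ring

/-- The unit for `listConv`. -/
def listUnit (l : List α) : ℕ := if l.isEmpty then 1 else 0

lemma listConv_zero_left (G : List α → ℕ) (l : List α) : listConv (fun _ => 0) G l = 0 := by
  induction l with
  | nil => simp [listConv]
  | cons b l ih => simp [listConv, ih]

lemma listConv_unit_left (G : List α → ℕ) (l : List α) : listConv listUnit G l = G l := by
  cases l with
  | nil => simp [listConv, listUnit]
  | cons b l => simp [listConv, listUnit, listConv_zero_left]

lemma listConv_unit_right (F : List α → ℕ) (l : List α) : listConv F listUnit l = F l := by
  induction l generalizing F with
  | nil => simp [listConv, listUnit]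
  | cons b l ih => simp [listConv, ih, listUnit]

/-- Powers with respect to `listConv`. -/
def listPow (F : List α → ℕ) : ℕ → List α → ℕ
  | 0 => listUnit
  | k + 1 => listConv (listPow F k) F

lemma listPow_one (F : List α → ℕ) : listPow F 1 = F :=
  funext fun l => listConv_unit_left F l

lemma listPow_add (F : List α → ℕ) (j k : ℕ) :
    listPow F (j + k) = listConv (listPow F j) (listPow F k) := by
  induction k with
  | zero => exact funext fun l => (listConv_unit_right _ l).symm
  | succ k ih =>
    funext l
    rw [← Nat.add_assoc, listPow, ih, listConv_assoc]
    rfl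

lemma listPow_succ' (F : List α → ℕ) (k : ℕ) :
    listPow F (k + 1) = listConv F (listPow F k) := by
  rw [Nat.add_comm, listPow_add, listPow_one]

end listConv

open List in
/-- The rotated word `∏ 0^j 1^a 0^{a-j}` over `a ∈ l`. -/
def shiftWord (j : ℕ) (l : List ℕ) : List Bool :=
  l.flatMap fun a => replicate j false ++ replicate a true ++ replicate (a - j) false

lemma shiftWord_nil (j : ℕ) : shiftWord j [] = [] := rfl

lemma shiftWord_zero (l : List ℕ) : shiftWord 0 l = symWord l := by
  simp [shiftWord, symWord]

lemma shiftWord_cons (j a : ℕ) (l : List ℕ) :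
    shiftWord j (a :: l) = List.replicate j false ++ List.replicate a true ++
      List.replicate (a - j) false ++ shiftWord j l := by
  simp [shiftWord]

lemma shiftWord_append (j : ℕ) (l l' : List ℕ) :
    shiftWord j (l ++ l') = shiftWord j l ++ shiftWord j l' := by
  simp [shiftWord]

lemma shiftWord_conj (i j : ℕ) (l : List ℕ) (h : ∀ a ∈ l, i + j ≤ a) :
    List.replicate i false ++ shiftWord j l =
      shiftWord (i + j) l ++ List.replicate i false := by
  induction l with
  | nil => simp [shiftWord]
  | cons a l ih =>
    have h₁ : i + j ≤ a := h a (by simp)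
    have h₂ : List.replicate (a - j) false =
        List.replicate (a - (i + j)) false ++ List.replicate i false := by
      rw [← List.replicate_add]
      congr 1
      omega
    rw [shiftWord_cons, shiftWord_cons, h₂, List.append_assoc,
      List.append_assoc _ _ (shiftWord j l),
      ih fun b hb => h b (by simp [hb]), List.replicate_add]
    simp only [List.append_assoc]

lemma phi_shiftWord (j : ℕ) (l : List ℕ) (h : ∀ a ∈ l, j ≤ a) :
    phi (shiftWord j l) = phiStar l := by
  cases l with
  | nil => simp [shiftWord, phiStar, symWord]
  | cons a l =>
    have h₁ := shiftWord_conj j 0 (a :: l) (by simpa using h)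
    obtain ⟨t, ht⟩ : ∃ t, shiftWord j (a :: l) = List.replicate j false ++ t :=
      ⟨_, by rw [shiftWord_cons, List.append_assoc, List.append_assoc]⟩
    rw [Nat.add_zero, ht, shiftWord_zero, List.append_assoc, List.append_cancel_left_eq] at h₁
    rw [phiStar, h₁, ht, phi_append_comm]

lemma count_shiftWord (j : ℕ) (l : List ℕ) (h : ∀ a ∈ l, j ≤ a) :
    (shiftWord j l).count true = (shiftWord j l).count false := by
  induction l with
  | nil => rfl
  | cons a l ih =>
    have h₁ : j ≤ a := h a (by simp)
    have h₂ := ih fun b hb => h b (by simp [hb])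
    rw [shiftWord_cons]
    simp [List.count_replicate]
    omega

lemma arcSum_block (p v : List Bool) {a j : ℕ} (ha : j + 1 ≤ a)
    (hp : p.count true + 1 = p.count false) :
    arcSum true (fun s => phi (p ++ s)) phi
        (List.replicate j false ++ (List.replicate a true ++ (List.replicate (a - j) false ++ v))) =
      phi (p ++ (List.replicate j false ++ (List.replicate a true ++
        List.replicate (a - j - 1) false))) * phi v +
      arcSum true (fun s => phi (p ++ (List.replicate j false ++ (List.replicate a true ++
        (List.replicate (a - j) false ++ s))))) phi v := by
  have hsplit : List.replicate (a - j) false = List.replicate (a - j - 1) false ++ [false] := by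
    rw [← List.replicate_succ']
    congr 1
    omega
  rw [hsplit, List.append_assoc, arcSum_append, arcSum_replicate_false, arcSum_append,
    arcSum_replicate_true, arcSum_append, arcSum_replicate_false, arcSum_append]
  · simp [arcSum]
  · intro i hi
    apply phi_eq_zero
    simp [List.count_replicate]
    omega
  · intro i hi
    apply phi_eq_zero
    simp [List.count_replicate]
    omega

lemma arcSum_shiftWord (m j : ℕ) (l l' : List ℕ) (hl : ∀ a ∈ l, m + 1 + j ≤ a)
    (hl' : ∀ a ∈ l', m + 1 + j ≤ a) :
    arcSum true (fun s => phi (List.replicate m true ++ List.replicate (m + 1) false ++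
        shiftWord j l' ++ s)) phi (shiftWord j l) +
      phi (List.replicate m true ++ List.replicate m false ++ shiftWord (j + 1) l') *
        phi (shiftWord j l) =
    listConv (fun s => phi (List.replicate m true ++ List.replicate m false ++
      shiftWord (j + 1) (l' ++ s))) (fun s => phi (shiftWord j s)) l := by
  induction l generalizing l' with
  | nil => simp [shiftWord, arcSum, listConv]
  | cons a l ih =>
    have ha : m + 1 + j ≤ a := hl a (by simp)
    have hc := count_shiftWord j l' fun b hb => by have := hl' b hb; omega
    have ih' := ih (l' ++ [a]) (fun b hb => hl b (by simp [hb])) (by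
      intro b hb
      rcases List.mem_append.mp hb with hb | hb
      · exact hl' b hb
      · rw [List.mem_singleton.mp hb]; exact ha)
    have hword : List.replicate m true ++ List.replicate (m + 1) false ++ shiftWord j l' ++
        (List.replicate j false ++ (List.replicate a true ++
          List.replicate (a - j - 1) false)) =
        List.replicate m true ++ List.replicate m false ++ shiftWord (j + 1) (l' ++ [a]) := by
      have h₁ := shiftWord_conj 1 j l' fun b hb => by have := hl' b hb; omega
      rw [List.replicate_succ', shiftWord_append, shiftWord_cons, Nat.add_comm j 1,
        List.replicate_add, ← Nat.sub_sub, Nat.sub_right_comm]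
      simp only [List.replicate_one, List.append_assoc] at h₁ ⊢
      rw [← List.append_assoc [false] (shiftWord j l'), h₁]
      simp [shiftWord]
    rw [listConv, List.append_nil]
    simp only [List.append_assoc, List.singleton_append] at ih' hword ⊢
    rw [← ih', Nat.add_comm]
    congr 1
    have h := arcSum_block (List.replicate m true ++ List.replicate (m + 1) false ++
      shiftWord j l') (shiftWord j l) (a := a) (j := j) (by omega)
      (by simp [List.count_replicate]; omega)
    rw [shiftWord_cons]
    simp only [List.append_assoc] at h ⊢
    rw [h, hword]
    simp [shiftWord_append, shiftWord_cons, shiftWord_nil, Nat.add_comm]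

lemma phi_replicate_shiftWord (m j : ℕ) (l : List ℕ) (hl : ∀ a ∈ l, m + j ≤ a) :
    phi (List.replicate m true ++ List.replicate m false ++ shiftWord j l) =
      listPow phiStar (m + 1) l := by
  induction m generalizing j l with
  | zero =>
    rw [listPow_one]
    simpa using phi_shiftWord j l (by simpa using hl)
  | succ m ih =>
    have h₁ := arcSum_shiftWord m j l [] hl (by simp)
    rw [listPow]
    have h₂ := listConv_congr (F' := listPow phiStar (m + 1)) (G' := phiStar)
      (F := fun s => phi (List.replicate m true ++ List.replicate m false ++
      shiftWord (j + 1) ([] ++ s))) (G := fun s => phi (shiftWord j s)) l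
      (fun s hs => by
        rw [List.nil_append]
        refine ih (j + 1) s fun a ha => ?_
        have := hl a (hs ha)
        omega)
      (fun s hs => phi_shiftWord j s fun a ha => by have := hl a (hs ha); omega)
    rw [← h₂, ← h₁, List.replicate_succ, List.cons_append, List.cons_append, phi_cons,
      arcSum_append, List.replicate_succ', ← List.append_assoc, arcSum_append, arcSum_append,
      arcSum_replicate_true, arcSum_replicate_false]
    · simp [arcSum, shiftWord, Nat.add_comm]
    · intro i hi
      apply phi_eq_zero
      simp [List.count_replicate]
      omega

lemma phiStar_nil : phiStar [] = 1 := phi_nil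

lemma phiStar_cons (m : ℕ) (l : List ℕ) (h : ∀ a ∈ l, m ≤ a) :
    phiStar (m :: l) = listPow phiStar (m + 1) l := by
  rw [← phi_replicate_shiftWord m 0 l (by simpa using h), shiftWord_zero]
  simp [phiStar, symWord]

lemma phiStar_concat (m : ℕ) (l : List ℕ) : phiStar (l ++ [m]) = phiStar (m :: l) := by
  simp only [phiStar, symWord, List.flatMap_append, List.flatMap_cons, List.flatMap_nil]
  rw [phi_append_comm, List.append_nil]

lemma listPow_phiStar_cons (m : ℕ) (l : List ℕ) (h : ∀ a ∈ l, m ≤ a) (k : ℕ) :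
    listPow phiStar (k + 1) (m :: l) =
      listPow phiStar k (m :: l) + listPow phiStar (m + 1 + k) l := by
  rw [listPow_succ', listConv, phiStar_nil, one_mul, listPow_add]
  congr 1
  exact listConv_congr l (fun s hs => phiStar_cons m s fun a ha => h a (hs ha)) fun _ _ => rfl

lemma listPow_phiStar_concat (m : ℕ) (l : List ℕ) (h : ∀ a ∈ l, m ≤ a) (k : ℕ) :
    listPow phiStar k (l ++ [m]) = listPow phiStar k (m :: l) := by
  induction k with
  | zero => simp [listPow, listUnit]
  | succ k ih =>
    rw [listPow_phiStar_cons m l h, listPow, listConv_concat, phiStar_nil, mul_one, ih,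
      Nat.add_comm, Nat.add_comm _ k, listPow_add]
    congr 1
    refine listConv_congr l (fun _ _ => rfl) fun s hs => ?_
    rw [phiStar_concat, phiStar_cons m s fun a ha => h a (hs ha)]

lemma listPow_phiStar_cons_congr (m : ℕ) {l l' : List ℕ} (h : ∀ a ∈ l, m ≤ a)
    (h' : ∀ a ∈ l', m ≤ a) (hl : ∀ k, listPow phiStar k l = listPow phiStar k l') (k : ℕ) :
    listPow phiStar k (m :: l) = listPow phiStar k (m :: l') := by
  induction k with
  | zero => simp [listPow, listUnit]
  | succ k ih => rw [listPow_phiStar_cons m l h, listPow_phiStar_cons m l' h', ih, hl]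

lemma listPow_phiStar_cons_insertionSort (m : ℕ) (l : List ℕ) (h : ∀ a ∈ l, m ≤ a)
    (hl : ∀ k, listPow phiStar k l = listPow phiStar k (l.insertionSort (· ≤ ·))) (k : ℕ) :
    listPow phiStar k (m :: l) =
      listPow phiStar k ((m :: l).insertionSort (· ≤ ·)) := by
  have hs : (m :: l).insertionSort (· ≤ ·) = m :: l.insertionSort (· ≤ ·) := by
    rw [List.insertionSort_cons]
    cases hc : l.insertionSort (· ≤ ·) with
    | nil => rfl
    | cons b t =>
      have hb : b ∈ l := by
        rw [← List.mem_insertionSort (r := (· ≤ ·)), hc]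
        simp
      exact List.orderedInsert_cons_of_le _ _ (h b hb)
  rw [hs]
  exact listPow_phiStar_cons_congr m h (by simpa using h) hl k

/-- An increasing list followed by a decreasing one may be sorted. -/
lemma listPow_phiStar_unimodal (n : ℕ) : ∀ l₁ l₂ : List ℕ, l₁.length + l₂.length = n →
    l₁.Pairwise (· ≤ ·) → l₂.Pairwise (· ≥ ·) → ∀ k,
      listPow phiStar k (l₁ ++ l₂) =
        listPow phiStar k ((l₁ ++ l₂).insertionSort (· ≤ ·)) := by
  induction n with
  | zero =>
    intro l₁ l₂ h
    simp only [Nat.add_eq_zero_iff, List.length_eq_zero_iff] at h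
    simp [h.1, h.2]
  | succ n ih =>
    have left : ∀ a l₁ l₂, (a :: l₁).length + l₂.length = n + 1 →
        (a :: l₁).Pairwise (· ≤ ·) → l₂.Pairwise (· ≥ ·) → (∀ b ∈ l₂, a ≤ b) → ∀ k,
        listPow phiStar k ((a :: l₁) ++ l₂) =
          listPow phiStar k (((a :: l₁) ++ l₂).insertionSort (· ≤ ·)) := by
      intro a l₁ l₂ hn h₁ h₂ hab
      rw [List.pairwise_cons] at h₁
      refine listPow_phiStar_cons_insertionSort a (l₁ ++ l₂) ?_
        (ih l₁ l₂ (by simp at hn; omega) h₁.2 h₂)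
      intro c hc
      rcases List.mem_append.mp hc with hc | hc
      · exact h₁.1 c hc
      · exact hab c hc
    have right : ∀ b l₁ l₂, l₁.length + (l₂ ++ [b]).length = n + 1 →
        l₁.Pairwise (· ≤ ·) → (l₂ ++ [b]).Pairwise (· ≥ ·) → (∀ a ∈ l₁, b ≤ a) → ∀ k,
        listPow phiStar k (l₁ ++ (l₂ ++ [b])) =
          listPow phiStar k ((l₁ ++ (l₂ ++ [b])).insertionSort (· ≤ ·)) := by
      intro b l₁ l₂ hn h₁ h₂ hab k
      rw [List.pairwise_append] at h₂
      have hb : ∀ c ∈ l₁ ++ l₂, b ≤ c := by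
        intro c hc
        rcases List.mem_append.mp hc with hc | hc
        · exact hab c hc
        · exact h₂.2.2 c hc b (by simp)
      have hp : (b :: (l₁ ++ l₂)).insertionSort (· ≤ ·) =
          (l₁ ++ l₂ ++ [b]).insertionSort (· ≤ ·) :=
        (((List.perm_insertionSort _ _).trans (List.perm_append_singleton b _).symm).trans
          (List.perm_insertionSort _ _).symm).eq_of_pairwise' (List.pairwise_insertionSort _ _)
          (List.pairwise_insertionSort _ _)
      rw [← List.append_assoc, listPow_phiStar_concat b _ hb, ← hp]
      exact listPow_phiStar_cons_insertionSort b _ hb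
        (ih l₁ l₂ (by simp at hn; omega) h₁ h₂.1) k
    intro l₁ l₂ hn h₁ h₂
    rcases List.eq_nil_or_concat l₂ with rfl | ⟨l₂, b, rfl⟩
    · cases l₁ with
      | nil => simp at hn
      | cons a l₁ => exact left a l₁ [] hn h₁ h₂ (by simp)
    · rw [List.concat_eq_append] at *
      cases l₁ with
      | nil => exact right b [] l₂ hn h₁ h₂ (by simp)
      | cons a l₁ =>
        rcases le_total a b with hab | hab
        · refine left a l₁ _ hn h₁ h₂ fun c hc => ?_
          rcases List.mem_append.mp hc with hc | hc
          · exact hab.trans ((List.pairwise_append.mp h₂).2.2 c hc b (by simp))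
          · rw [List.mem_singleton.mp hc]; exact hab
        · refine right b _ l₂ hn h₁ h₂ fun c hc => ?_
          rcases List.mem_cons.mp hc with rfl | hc
          · exact hab
          · exact hab.trans ((List.pairwise_cons.mp h₁).1 c hc)

/-- If `n'₁ ≤ ⋯ ≤ n'_r` and `σ` is a unimodal permutation, then
`φ*(n'_{σ(1)},…,n'_{σ(r)}) = φ*(n'₁,…,n'_r)`. -/
theorem stmt15 (r : ℕ) (hr : 1 ≤ r) (n' : Fin r → ℕ) (hmono : Monotone n')
    (σ : Equiv.Perm (Fin r))
    (huni : ∃ k : Fin r,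
      (∀ i j : Fin r, i < j → j ≤ k → (σ i : ℕ) ≤ (σ j : ℕ) ∧ (σ j : ℕ) ≤ (σ k : ℕ)) ∧
      (∀ i j : Fin r, k ≤ i → i < j → (σ j : ℕ) ≤ (σ i : ℕ) ∧ (σ i : ℕ) ≤ (σ k : ℕ))) :
    phiStar ((List.finRange r).map fun i => n' (σ i)) =
      phiStar ((List.finRange r).map n') := by
  obtain ⟨k, h₁, h₂⟩ := huni
  set l := (List.finRange r).map fun i => n' (σ i) with hl
  have hsort : l.insertionSort (· ≤ ·) = (List.finRange r).map n' := by
    refine ((List.perm_insertionSort _ _).trans ?_).eq_of_pairwise'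
      (List.pairwise_insertionSort _ _) ?_
    · have h := (σ.map_finRange_perm).map n'
      rwa [List.map_map] at h
    · rw [List.pairwise_map]
      exact (List.pairwise_lt_finRange r).imp fun h => hmono h.le
  have h := listPow_phiStar_unimodal _ (l.take (k + 1)) (l.drop (k + 1)) rfl
    (by
      rw [List.pairwise_iff_getElem]
      intro i j hi hj hij
      simp [hl] at hi hj ⊢
      exact hmono (h₁ _ _ (by simpa using hij) (by rw [Fin.le_def]; simp; omega)).1)
    (by
      rw [List.pairwise_iff_getElem]
      intro i j hi hj hij
      simp [hl] at hi hj ⊢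
      exact hmono (h₂ _ _ (by rw [Fin.le_def]; simp; omega) (by simpa using hij)).1) 1
  rwa [List.take_append_drop, listPow_one, hsort] at h
end

section
/- Let r ≥ 1, let n_1,…,n_r, m_1,…,m_r be positive integers with n_1+⋯+n_r = m_1+⋯+m_r, set n = (n_1,…,n_r), and let n' = (n'_1,…,n'_r) be an r-tuple of positive integers that dominates n (i.e., n'_1+⋯+n'_j ≥ n_1+⋯+n_j for all 1 ≤ j ≤ r). Then there exists i ∈ {1,…,r} such that φ(1^{n_1}0^{m_1}⋯1^{n_r}0^{m_r}) ≤ |CF(n'_i, n'_{i+1}, …, n'_r, n'_1, …, n'_{i−1})|. -/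
/-- `f` is the partner map of a non-crossing pairing of unequal letters of `w`. -/
structure IsPartnerMap {N : ℕ} (w : Fin N → Bool) (f : Fin N → Fin N) : Prop where
  invol : ∀ k, f (f k) = k
  letter_ne : ∀ k, w (f k) ≠ w k
  noncrossing : ∀ i j, i < j → j < f i → f i < f j → False

/-- `ρ` splits the positions of `w` into consecutive runs, each of the form `1⋯10⋯0`. -/
structure IsRunIndex {N : ℕ} (w : Fin N → Bool) (ρ : Fin N → ℕ) : Prop where
  mono : Monotone ρ
  ones_first : ∀ i k, i ≤ k → ρ i = ρ k → w k = true → w i = true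

/-- The ones covered by an arc that joins a one to a later zero lying in one of the first `j`
runs. -/
def coveredOnes {N : ℕ} (w : Fin N → Bool) (ρ : Fin N → ℕ) (f : Fin N → Fin N) (j : ℕ) :
    Finset (Fin N) :=
  Finset.univ.filter fun x => w x = true ∧ ∃ k, w k = true ∧ k ≤ x ∧ x < f k ∧ ρ (f k) < j

/-- The sign of a letter: `1` for a one and `-1` for a zero. -/
def letterSign (b : Bool) : ℤ := if b then 1 else -1

section PartnerMap

variable {N : ℕ} {w : Fin N → Bool} {ρ : Fin N → ℕ} {f g : Fin N → Fin N}

lemma IsPartnerMap.apply_ne (hf : IsPartnerMap w f) (k : Fin N) : f k ≠ k := fun h =>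
  hf.letter_ne k (by rw [h])

lemma IsPartnerMap.letter_eq_true (hf : IsPartnerMap w f) {k : Fin N} (hk : w k = false) :
    w (f k) = true := by
  have := hf.letter_ne k
  rw [hk] at this
  simpa using this

lemma IsPartnerMap.letter_eq_false (hf : IsPartnerMap w f) {k : Fin N} (hk : w k = true) :
    w (f k) = false := by
  have := hf.letter_ne k
  rw [hk] at this
  simpa using this

lemma IsPartnerMap.letterSign_apply (hf : IsPartnerMap w f) (k : Fin N) :
    letterSign (w (f k)) = -letterSign (w k) := by
  have := hf.letter_ne k
  cases h : w k <;> cases h' : w (f k) <;> simp_all [letterSign]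

lemma IsPartnerMap.sum_eq_zero (hf : IsPartnerMap w f) (R : Finset (Fin N))
    (hR : ∀ k ∈ R, f k ∈ R) : ∑ k ∈ R, letterSign (w k) = 0 := by
  refine Finset.sum_involution (fun k _ => f k) ?_ ?_ hR ?_
  · intro k _
    rw [hf.letterSign_apply]; ring
  · intro k _ _
    exact hf.apply_ne k
  · intro k _
    exact hf.invol k

/-- Positions strictly inside an arc have their partners strictly inside that arc. -/
lemma IsPartnerMap.apply_mem_Ioo (hf : IsPartnerMap w f) {i k : Fin N}
    (hk : k ∈ Finset.Ioo i (f i)) : f k ∈ Finset.Ioo i (f i) := by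
  rw [Finset.mem_Ioo] at hk ⊢
  obtain ⟨h1, h2⟩ := hk
  have n1 : f k ≠ i := by
    rintro rfl
    rw [hf.invol] at h2; exact lt_irrefl _ h2
  have n2 : f k ≠ f i := by
    intro h
    have := congrArg f h
    rw [hf.invol, hf.invol] at this
    exact h1.ne' this
  constructor
  · by_contra h
    have h3 : f k < i := lt_of_le_of_ne (not_lt.1 h) n1
    exact hf.noncrossing (f k) i h3 (by rwa [hf.invol]) (by rwa [hf.invol])
  · by_contra h
    have h3 : f i < f k := lt_of_le_of_ne (not_lt.1 h) n2.symm
    exact hf.noncrossing i k h1 h2 h3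

/-- A set of positions with more ones than zeros contains a one whose partner lies outside. -/
lemma IsPartnerMap.exists_of_sum_pos (hf : IsPartnerMap w f) (J : Finset (Fin N))
    (hJ : 0 < ∑ k ∈ J, letterSign (w k)) : ∃ k ∈ J, w k = true ∧ f k ∉ J := by
  by_contra! h
  have h1 : ∑ k ∈ J with f k ∈ J, letterSign (w k) = 0 := by
    apply hf.sum_eq_zero
    intro k hk
    rw [Finset.mem_filter] at hk ⊢
    exact ⟨hk.2, by rw [hf.invol]; exact hk.1⟩
  have h2 : ∑ k ∈ J with f k ∉ J, letterSign (w k) ≤ 0 := by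
    apply Finset.sum_nonpos
    intro k hk
    rw [Finset.mem_filter] at hk
    cases hw : w k
    · simp [letterSign]
    · exact absurd (h k hk.1 hw) hk.2
  have := Finset.sum_filter_add_sum_filter_not J (fun k => f k ∈ J) (fun k => letterSign (w k))
  omega

lemma IsRunIndex.lt_of_lt (hρ : IsRunIndex w ρ) {z x : Fin N} (hzx : z < x)
    (hz : w z = false) (hx : w x = true) : ρ z < ρ x := by
  refine lt_of_le_of_ne (hρ.mono hzx.le) fun h => ?_
  have := hρ.ones_first z x hzx.le h hx
  rw [hz] at this; cases this

lemma not_lt_of_isGreatest (hρ : IsRunIndex w ρ) (hf : IsPartnerMap w f)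
    (hg : IsPartnerMap w g) {R : Finset (Fin N)} {z : Fin N} (hzR : z ∈ R)
    (hmax : ∀ k ∈ R, k ≤ z) (hconn : ∀ k ∈ R, ∀ l, k ≤ l → l ≤ z → l ∈ R)
    (hfR : ∀ k ∈ R, f k ∈ R) (hgR : ∀ k ∈ R, g k ∈ R) (hz : w z = false)
    (ih : ∀ d, w d = false → ρ d < ρ z → g d < d → f d = g d) : ¬ f z < g z := by
  intro hlt
  have hfz : f z < z := lt_of_le_of_ne (hmax _ (hfR _ hzR)) (hf.apply_ne z)
  have hgz : g z < z := lt_of_le_of_ne (hmax _ (hgR _ hzR)) (hg.apply_ne z)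
  have hsum : ∑ k ∈ R with k ≤ f z, letterSign (w k) = 1 := by
    have h0 := hf.sum_eq_zero R hfR
    rw [← Finset.sum_filter_add_sum_filter_not R (fun k => k ≤ f z)] at h0
    have hrest : R.filter (fun k => ¬ k ≤ f z) = insert z (Finset.Ioo (f z) (f (f z))) := by
      ext k
      simp only [Finset.mem_filter, Finset.mem_insert, Finset.mem_Ioo, hf.invol, not_le]
      constructor
      · rintro ⟨h1, h2⟩
        rcases (hmax k h1).eq_or_lt with h | h
        · exact Or.inl h
        · exact Or.inr ⟨h2, h⟩
      · rintro (rfl | ⟨h1, h2⟩)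
        · exact ⟨hzR, hfz⟩
        · exact ⟨hconn _ (hfR _ hzR) _ h1.le h2.le, h1⟩
    have hz0 : z ∉ Finset.Ioo (f z) (f (f z)) := by simp [hf.invol]
    rw [hrest, Finset.sum_insert hz0,
      hf.sum_eq_zero _ (fun k hk => hf.apply_mem_Ioo hk), hz] at h0
    simp only [letterSign, Bool.false_eq_true, if_false] at h0 ⊢
    omega
  obtain ⟨k, hkJ, hk1, hkout⟩ := hg.exists_of_sum_pos _ (by rw [hsum]; norm_num)
  rw [Finset.mem_filter] at hkJ
  have hgkR := hgR _ hkJ.1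
  have hgk : f z < g k := by
    by_contra h
    exact hkout (Finset.mem_filter.2 ⟨hgkR, not_lt.1 h⟩)
  have hgk0 := hg.letter_eq_false hk1
  have hne : g k ≠ z := by
    intro h
    have h' : k = g z := by rw [← h, hg.invol]
    exact absurd hkJ.2 (by rw [h']; exact not_le.2 hlt)
  have hgkz : g k < z := lt_of_le_of_ne (hmax _ hgkR) hne
  have hgkx : g k < g z := by
    by_contra h
    rcases (not_lt.1 h).eq_or_lt with h | h
    · rw [← h, hg.letter_eq_true hz] at hgk0; cases hgk0
    · exact hg.noncrossing k (g z) (hkJ.2.trans_lt hlt) h (by rwa [hg.invol])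
  have hρd : ρ (g k) < ρ z :=
    (hρ.lt_of_lt hgkx hgk0 (hg.letter_eq_true hz)).trans_le (hρ.mono hgz.le)
  have hfd := ih (g k) hgk0 hρd (by rw [hg.invol]; exact hkJ.2.trans_lt hgk)
  rw [hg.invol] at hfd
  have hfk : f k = g k := by
    conv_lhs => rw [← hfd]
    exact hf.invol _
  rcases hkJ.2.eq_or_lt with h | h
  · rw [h, hf.invol, ← h] at hfk
    exact hne hfk.symm
  · exact hf.noncrossing k (f z) h (by rwa [hfk]) (by rw [hfk, hf.invol]; exact hgkz)

/-- Two partner maps preserving a convex set `R` agree at its greatest element `z` if that is a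
zero and they have the same arcs from ones to zeros of earlier runs. -/
lemma apply_eq_of_isGreatest (hρ : IsRunIndex w ρ) (hf : IsPartnerMap w f)
    (hg : IsPartnerMap w g) {R : Finset (Fin N)} {z : Fin N} (hzR : z ∈ R)
    (hmax : ∀ k ∈ R, k ≤ z) (hconn : ∀ k ∈ R, ∀ l, k ≤ l → l ≤ z → l ∈ R)
    (hfR : ∀ k ∈ R, f k ∈ R) (hgR : ∀ k ∈ R, g k ∈ R) (hz : w z = false)
    (ih : ∀ d, w d = false → ρ d < ρ z → (f d < d ∨ g d < d) → f d = g d) : f z = g z :=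
  le_antisymm
    (not_lt.1 (not_lt_of_isGreatest hρ hg hf hzR hmax hconn hgR hfR hz
      fun d h1 h2 h3 => (ih d h1 h2 (Or.inl h3)).symm))
    (not_lt.1 (not_lt_of_isGreatest hρ hf hg hzR hmax hconn hfR hgR hz
      fun d h1 h2 h3 => ih d h1 h2 (Or.inr h3)))

/-- Agreement of the arcs ending at a zero propagates to the preceding zeros of its run. -/
lemma apply_eq_of_le (hρ : IsRunIndex w ρ) (hf : IsPartnerMap w f) (hg : IsPartnerMap w g)
    {z : Fin N} (hz : w z = false) (hfz : f z < z) (hfg : f z = g z)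
    (ih : ∀ d, w d = false → ρ d < ρ z → (f d < d ∨ g d < d) → f d = g d) (t : ℕ) :
    ∀ y : Fin N, w y = false → ρ y = ρ z → (y : ℕ) + t = z → f y = g y ∧ f y < y := by
  induction t with
  | zero =>
    intro y _ _ hyz
    obtain rfl : y = z := Fin.ext hyz
    exact ⟨hfg, hfz⟩
  | succ t iht =>
    intro y hy hyρ hyz
    have hlt : (y : ℕ) + 1 < N := by have := z.2; omega
    set s : Fin N := ⟨y + 1, hlt⟩ with hs
    have hys : y < s := Fin.lt_def.2 (by simp [hs])
    have hsz : s ≤ z := Fin.le_def.2 (by simp only [hs]; omega)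
    have hsρ : ρ s = ρ z := le_antisymm (hρ.mono hsz) (hyρ ▸ hρ.mono hys.le)
    have hs0 : w s = false := by
      by_contra h
      have := hρ.ones_first y s hys.le (hyρ.trans hsρ.symm) (by simpa using h)
      rw [hy] at this; cases this
    obtain ⟨e, hfs⟩ := iht s hs0 hsρ (by simp only [hs]; omega)
    have hfsy : f s < y := by
      have h1 : f s ≤ y := by
        have := Fin.lt_def.1 hfs
        simp only [hs] at this
        exact Fin.le_def.2 (by simp only [hs]; omega)
      refine lt_of_le_of_ne h1 fun h => ?_
      have := hf.letter_eq_true hs0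
      rw [h, hy] at this; cases this
    have hstab : ∀ k ∈ Finset.Ioo (f s) s, f k ∈ Finset.Ioo (f s) s := by
      intro k hk
      have := hf.apply_mem_Ioo (i := f s) (k := k)
      rw [hf.invol] at this
      exact this hk
    have hstab' : ∀ k ∈ Finset.Ioo (f s) s, g k ∈ Finset.Ioo (f s) s := by
      intro k hk
      have := hg.apply_mem_Ioo (i := g s) (k := k)
      rw [hg.invol, ← e] at this
      exact this hk
    have hymem : y ∈ Finset.Ioo (f s) s := Finset.mem_Ioo.2 ⟨hfsy, hys⟩
    have hmax : ∀ k ∈ Finset.Ioo (f s) s, k ≤ y := by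
      intro k hk
      have := Fin.lt_def.1 (Finset.mem_Ioo.1 hk).2
      simp only [hs] at this
      exact Fin.le_def.2 (by omega)
    refine ⟨apply_eq_of_isGreatest hρ hf hg hymem hmax ?_ hstab hstab' hy ?_,
      lt_of_le_of_ne (hmax _ (hstab _ hymem)) (hf.apply_ne y)⟩
    · intro k hk l hkl hly
      exact Finset.mem_Ioo.2 ⟨(Finset.mem_Ioo.1 hk).1.trans_le hkl, hly.trans_lt hys⟩
    · rw [hyρ]; exact ih

lemma coveredOnes_mono (w : Fin N → Bool) (ρ : Fin N → ℕ) (f : Fin N → Fin N) :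
    Monotone (coveredOnes w ρ f) := by
  intro i j hij x hx
  simp only [coveredOnes, Finset.mem_filter, Finset.mem_univ, true_and] at hx ⊢
  obtain ⟨h, k, h1, h2, h3, h4⟩ := hx
  exact ⟨h, k, h1, h2, h3, h4.trans_le hij⟩

lemma coveredOnes_subset_of (hf : IsPartnerMap w f) (hg : IsPartnerMap w g) {j : ℕ}
    (ih : ∀ d, w d = false → ρ d < j → (f d < d ∨ g d < d) → f d = g d) :
    coveredOnes w ρ f j ⊆ coveredOnes w ρ g j := by
  intro x hx
  simp only [coveredOnes, Finset.mem_filter, Finset.mem_univ, true_and] at hx ⊢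
  obtain ⟨h, k, h1, h2, h3, h4⟩ := hx
  have e := ih (f k) (hf.letter_eq_false h1) h4
    (Or.inl (by rw [hf.invol]; exact h2.trans_lt h3))
  rw [hf.invol] at e
  have e' : g k = f k := by
    conv_lhs => rw [e]
    exact hg.invol _
  exact ⟨h, k, h1, h2, by rwa [e'], by rwa [e']⟩

lemma coveredOnes_eq_of (hf : IsPartnerMap w f) (hg : IsPartnerMap w g) {j : ℕ}
    (ih : ∀ d, w d = false → ρ d < j → (f d < d ∨ g d < d) → f d = g d) :
    coveredOnes w ρ f j = coveredOnes w ρ g j :=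
  (coveredOnes_subset_of hf hg ih).antisymm
    (coveredOnes_subset_of hg hf fun d h1 h2 h3 => (ih d h1 h2 h3.symm).symm)

lemma coveredOnes_zero : coveredOnes w ρ f 0 = ∅ := by
  simp [coveredOnes]

lemma coveredOnes_subset (hρ : IsRunIndex w ρ) (j : ℕ) :
    coveredOnes w ρ f j ⊆ Finset.univ.filter fun x => w x = true ∧ ρ x < j := by
  intro x hx
  simp only [coveredOnes, Finset.mem_filter, Finset.mem_univ, true_and] at hx ⊢
  obtain ⟨h, k, h1, h2, h3, h4⟩ := hx
  exact ⟨h, (hρ.mono h3.le).trans_lt h4⟩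

/-- The ones of the first `j + 1` runs not covered by arcs ending in the first `j` runs, from
position `x` on. -/
def uncoveredFrom {N : ℕ} (w : Fin N → Bool) (ρ : Fin N → ℕ) (f : Fin N → Fin N) (j : ℕ)
    (x : Fin N) : Finset (Fin N) :=
  Finset.univ.filter fun y => w y = true ∧ ρ y ≤ j ∧ y ∉ coveredOnes w ρ f j ∧ x ≤ y

/-- If `z` is the last zero of run `j` that ends an arc, then the arcs ending in run `j` newly
cover exactly the uncovered ones from the partner of `z` on. -/
lemma coveredOnes_succ_sdiff (hρ : IsRunIndex w ρ) (hf : IsPartnerMap w f) {j : ℕ} {z : Fin N}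
    (hz : w z = false) (hzj : ρ z = j) (hfz : f z < z)
    (hlast : ∀ y, w y = false → ρ y = j → f y < y → y ≤ z) :
    coveredOnes w ρ f (j + 1) \ coveredOnes w ρ f j = uncoveredFrom w ρ f j (f z) := by
  ext x
  simp only [Finset.mem_sdiff, uncoveredFrom, Finset.mem_filter, Finset.mem_univ, true_and]
  constructor
  · rintro ⟨h, hn⟩
    simp only [coveredOnes, Finset.mem_filter, Finset.mem_univ, true_and] at h
    obtain ⟨hx1, k, h1, h2, h3, h4⟩ := h
    refine ⟨hx1, (hρ.mono h3.le).trans (Nat.lt_succ_iff.1 h4), hn, ?_⟩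
    have hj : ρ (f k) = j := by
      by_contra hne
      apply hn
      simp only [coveredOnes, Finset.mem_filter, Finset.mem_univ, true_and]
      exact ⟨hx1, k, h1, h2, h3, by omega⟩
    have hle := hlast (f k) (hf.letter_eq_false h1) hj
      (by rw [hf.invol]; exact h2.trans_lt h3)
    refine le_trans ?_ h2
    by_contra hlt
    have hlt := not_le.1 hlt
    have hne : f k ≠ z := by
      rintro rfl
      rw [hf.invol] at hlt
      exact lt_irrefl _ hlt
    have hfzk : f z < f k := by
      by_contra hge
      have h5 := hρ.lt_of_lt (lt_of_le_of_ne (not_lt.1 hge) fun h => by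
        have := hf.letter_eq_true hz
        rw [← h, hf.letter_eq_false h1] at this; cases this)
        (hf.letter_eq_false h1) (hf.letter_eq_true hz)
      have := hρ.mono hfz.le
      omega
    exact hf.noncrossing k (f z) hlt hfzk (by rw [hf.invol]; exact lt_of_le_of_ne hle hne)
  · rintro ⟨hx1, hx2, hn, hx3⟩
    refine ⟨?_, hn⟩
    simp only [coveredOnes, Finset.mem_filter, Finset.mem_univ, true_and]
    refine ⟨hx1, f z, hf.letter_eq_true hz, hx3, ?_, by rw [hf.invol]; omega⟩
    rw [hf.invol]
    by_contra hge
    have h5 := hρ.lt_of_lt (lt_of_le_of_ne (not_lt.1 hge) fun h => by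
      rw [← h, hz] at hx1; cases hx1) hz hx1
    omega

lemma apply_mem_uncoveredFrom (hρ : IsRunIndex w ρ) (hf : IsPartnerMap w f) {j : ℕ} {z : Fin N}
    (hz : w z = false) (hzj : ρ z = j) (hfz : f z < z) :
    f z ∈ uncoveredFrom w ρ f j (f z) := by
  simp only [uncoveredFrom, Finset.mem_filter, Finset.mem_univ, true_and]
  refine ⟨hf.letter_eq_true hz, hzj ▸ hρ.mono hfz.le, ?_, le_rfl⟩
  simp only [coveredOnes, Finset.mem_filter, Finset.mem_univ, true_and]
  rintro ⟨-, k, h1, h2, h3, h4⟩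
  have hkz : f k < z := by
    by_contra h
    have := hρ.mono (not_lt.1 h)
    omega
  rcases h2.eq_or_lt with h | h
  · rw [h, hf.invol] at hkz; exact lt_irrefl _ hkz
  · exact hf.noncrossing k (f z) h h3 (by rwa [hf.invol])

/-- If an arc of `f` ends in run `j`, then the last such zero exists. -/
lemma exists_last_closer (f : Fin N → Fin N) {j : ℕ} {z : Fin N}
    (hz : w z = false) (hzj : ρ z = j) (hfz : f z < z) :
    ∃ z, w z = false ∧ ρ z = j ∧ f z < z ∧
      ∀ y, w y = false → ρ y = j → f y < y → y ≤ z := by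
  obtain ⟨m, hm, hmax⟩ := Finset.exists_max_image
    (Finset.univ.filter fun y => w y = false ∧ ρ y = j ∧ f y < y) id
    ⟨z, by simp [hz, hzj, hfz]⟩
  simp only [Finset.mem_filter, Finset.mem_univ, true_and, id] at hm hmax
  exact ⟨m, hm.1, hm.2.1, hm.2.2, fun y h1 h2 h3 => hmax y ⟨h1, h2, h3⟩⟩

lemma exists_closer_of_card_lt (hf : IsPartnerMap w f) {j : ℕ}
    (h : (coveredOnes w ρ f j).card < (coveredOnes w ρ f (j + 1)).card) :
    ∃ z, w z = false ∧ ρ z = j ∧ f z < z := by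
  by_contra! hno
  refine absurd h (not_lt.2 (Finset.card_le_card ?_))
  intro x hx
  simp only [coveredOnes, Finset.mem_filter, Finset.mem_univ, true_and] at hx ⊢
  obtain ⟨h, k, h1, h2, h3, h4⟩ := hx
  refine ⟨h, k, h1, h2, h3, ?_⟩
  by_contra h5
  have := hno (f k) (hf.letter_eq_false h1) (by omega)
  rw [hf.invol] at this
  exact absurd (h2.trans_lt h3) (not_lt.2 this)

lemma not_lt_of_common_opener (hρ : IsRunIndex w ρ) (hf : IsPartnerMap w f)
    (hg : IsPartnerMap w g) {y z : Fin N} (hz : w z = false)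
    (hyz : ρ z = ρ y) (hfz : f z < z) (hfg : f z = g y) : ¬ z < y := by
  intro hlt
  have h1 := hf.sum_eq_zero (Finset.Ioo (f z) (f (f z))) fun k hk => hf.apply_mem_Ioo hk
  have h2 := hg.sum_eq_zero (Finset.Ioo (g y) (g (g y))) fun k hk => hg.apply_mem_Ioo hk
  rw [hf.invol] at h1
  rw [hg.invol, ← hfg] at h2
  have hsplit : Finset.Ioo (f z) y = Finset.Ioo (f z) z ∪ Finset.Ico z y := by
    ext k
    simp only [Finset.mem_Ioo, Finset.mem_union, Finset.mem_Ico]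
    constructor
    · rintro ⟨a, b⟩
      rcases lt_or_ge k z with h | h
      · exact Or.inl ⟨a, h⟩
      · exact Or.inr ⟨h, b⟩
    · rintro (⟨a, b⟩ | ⟨a, b⟩)
      · exact ⟨a, b.trans hlt⟩
      · exact ⟨hfz.trans_le a, b⟩
  have hdisj : Disjoint (Finset.Ioo (f z) z) (Finset.Ico z y) := by
    rw [Finset.disjoint_left]
    intro k hk hk'
    exact absurd (Finset.mem_Ioo.1 hk).2 (not_lt.2 (Finset.mem_Ico.1 hk').1)
  rw [hsplit, Finset.sum_union hdisj, h1, zero_add] at h2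
  have hneg : ∑ k ∈ Finset.Ico z y, letterSign (w k) < 0 := by
    refine Finset.sum_neg (fun k hk => ?_) ⟨z, Finset.mem_Ico.2 ⟨le_rfl, hlt⟩⟩
    rw [Finset.mem_Ico] at hk
    cases hw : w k
    · simp [letterSign]
    · have h3 := hρ.ones_first z k hk.1
        (le_antisymm (hρ.mono hk.1) (hyz ▸ hρ.mono hk.2.le)) hw
      rw [hz] at h3; cases h3
  omega

/-- Partner maps with equally many covered ones in run `j` have the same last arc there. -/
lemma last_closer_agree (hρ : IsRunIndex w ρ) (hf : IsPartnerMap w f) (hg : IsPartnerMap w g)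
    {j : ℕ} (ih : ∀ d, w d = false → ρ d < j → (f d < d ∨ g d < d) → f d = g d)
    (hcard : (coveredOnes w ρ f (j + 1)).card = (coveredOnes w ρ g (j + 1)).card)
    {z : Fin N} (hz : w z = false) (hzj : ρ z = j) (hfz : f z < z) :
    ∃ y, w y = false ∧ ρ y = j ∧ f y < y ∧ f y = g y ∧
      ∀ x, w x = false → ρ x = j → (f x < x ∨ g x < x) → x ≤ y := by
  obtain ⟨a, ha, haj, hfa, hamax⟩ := exists_last_closer (w := w) (ρ := ρ) f hz hzj hfz
  have hcov := coveredOnes_eq_of hf hg ih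
  have hfcard := Finset.card_sdiff_add_card_eq_card
    (coveredOnes_mono w ρ f (Nat.le_succ j))
  rw [coveredOnes_succ_sdiff hρ hf ha haj hfa hamax] at hfcard
  have hamem := apply_mem_uncoveredFrom hρ hf ha haj hfa
  have hpos : 0 < (uncoveredFrom w ρ f j (f a)).card := Finset.card_pos.2 ⟨_, hamem⟩
  obtain ⟨z', hz', hzj', hgz'⟩ := exists_closer_of_card_lt (j := j) (ρ := ρ) hg (by
    rw [← hcov]; simp only [Nat.succ_eq_add_one] at hfcard; omega)
  obtain ⟨b, hb, hbj, hgb, hbmax⟩ := exists_last_closer (w := w) (ρ := ρ) g hz' hzj' hgz'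
  have hgcard := Finset.card_sdiff_add_card_eq_card
    (coveredOnes_mono w ρ g (Nat.le_succ j))
  rw [coveredOnes_succ_sdiff hρ hg hb hbj hgb hbmax] at hgcard
  have hbmem := apply_mem_uncoveredFrom hρ hg hb hbj hgb
  have hU : ∀ x, uncoveredFrom w ρ f j x = uncoveredFrom w ρ g j x := by
    intro x; simp only [uncoveredFrom, hcov]
  rw [← hU] at hgcard hbmem
  have hanti : ∀ x y, x ≤ y → uncoveredFrom w ρ f j y ⊆ uncoveredFrom w ρ f j x := by
    intro x y hxy u hu
    simp only [uncoveredFrom, Finset.mem_filter, Finset.mem_univ, true_and] at hu ⊢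
    exact ⟨hu.1, hu.2.1, hu.2.2.1, hxy.trans hu.2.2.2⟩
  have hle : ∀ {x y}, x ∈ uncoveredFrom w ρ f j y → y ≤ x := by
    intro x y h
    simp only [uncoveredFrom, Finset.mem_filter] at h
    exact h.2.2.2.2
  have hcardeq : (uncoveredFrom w ρ f j (f a)).card = (uncoveredFrom w ρ f j (g b)).card := by
    have := congrArg Finset.card hcov
    simp only [Nat.succ_eq_add_one] at hfcard hgcard
    omega
  have hab : f a = g b := by
    rcases le_total (f a) (g b) with h | h
    · have := Finset.eq_of_subset_of_card_le (hanti _ _ h) hcardeq.le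
      exact le_antisymm h (hle (this ▸ hamem))
    · have := Finset.eq_of_subset_of_card_le (hanti _ _ h) hcardeq.ge
      exact le_antisymm (hle (this ▸ hbmem)) h
  have heq : a = b := le_antisymm
    (not_lt.1 (not_lt_of_common_opener hρ hg hf hb (hbj.trans haj.symm) hgb hab.symm))
    (not_lt.1 (not_lt_of_common_opener hρ hf hg ha (haj.trans hbj.symm) hfa hab))
  subst heq
  exact ⟨a, ha, haj, hfa, hab, fun x h1 h2 h3 => h3.elim (hamax x h1 h2) (hbmax x h1 h2)⟩

/-- Arcs from ones to zeros are determined by the numbers of covered ones. -/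
lemma closers_agree (hρ : IsRunIndex w ρ) (hf : IsPartnerMap w f) (hg : IsPartnerMap w g)
    {r : ℕ} (hr : ∀ k, ρ k < r)
    (hcard : ∀ j < r, (coveredOnes w ρ f j).card = (coveredOnes w ρ g j).card) (j : ℕ) :
    ∀ d, w d = false → ρ d = j → (f d < d ∨ g d < d) → f d = g d := by
  induction j using Nat.strong_induction_on with
  | _ j ih =>
  replace ih : ∀ d, w d = false → ρ d < j → (f d < d ∨ g d < d) → f d = g d :=
    fun d h1 h2 h3 => ih _ h2 d h1 rfl h3
  intro d hd hdj hcl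
  have key : ∃ y, w y = false ∧ ρ y = j ∧ f y < y ∧ f y = g y ∧ d ≤ y := by
    by_cases hj : j + 1 < r
    · rcases hcl with h | h
      · obtain ⟨y, h1, h2, h3, h4, h5⟩ := last_closer_agree hρ hf hg ih (hcard _ hj) hd hdj h
        exact ⟨y, h1, h2, h3, h4, h5 d hd hdj (Or.inl h)⟩
      · obtain ⟨y, h1, h2, h3, h4, h5⟩ := last_closer_agree hρ hg hf
          (fun d h1 h2 h3 => (ih d h1 h2 h3.symm).symm) (hcard _ hj).symm hd hdj h
        exact ⟨y, h1, h2, h4 ▸ h3, h4.symm, h5 d hd hdj (Or.inl h)⟩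
    · have hN : 0 < N := d.pos
      set z : Fin N := ⟨N - 1, by omega⟩ with hzdef
      have hle : ∀ k : Fin N, k ≤ z := fun k => Fin.le_def.2 (by
        have := k.2; simp only [hzdef]; omega)
      have hzj : ρ z = j := by
        have := hρ.mono (hle d)
        have := hr z
        omega
      have hz : w z = false := by
        by_contra h
        have := hρ.ones_first d z (hle d) (hdj.trans hzj.symm) (by simpa using h)
        rw [hd] at this; cases this
      refine ⟨z, hz, hzj, lt_of_le_of_ne (hle _) (hf.apply_ne z), ?_, hle d⟩
      exact apply_eq_of_isGreatest hρ hf hg (Finset.mem_univ z) (fun k _ => hle k)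
        (fun _ _ _ _ _ => Finset.mem_univ _) (fun _ _ => Finset.mem_univ _)
        (fun _ _ => Finset.mem_univ _) hz (by rw [hzj]; exact ih)
  obtain ⟨y, h1, h2, h3, h4, h5⟩ := key
  exact (apply_eq_of_le hρ hf hg h1 h3 h4 (by rw [h2]; exact ih) (y - d : ℕ) d hd
    (hdj.trans h2.symm) (by have := Fin.le_def.1 h5; omega)).1

lemma opener_apply_le (hf : IsPartnerMap w f) (hg : IsPartnerMap w g)
    (hcl : ∀ d, w d = false → (f d < d ∨ g d < d) → f d = g d) (t : ℕ) :
    ∀ z : Fin N, w z = false → (z : ℕ) + t = N → z < f z → z < g z → g z ≤ f z := by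
  induction t using Nat.strong_induction_on with
  | _ t ih =>
  intro z hz ht hfz hgz
  by_contra hlt
  have hlt := not_le.1 hlt
  have hx : w (f z) = true := hf.letter_eq_true hz
  have hmem := Finset.mem_Ioo.1 (hg.apply_mem_Ioo (Finset.mem_Ioo.2 ⟨hfz, hlt⟩))
  set u := g (f z) with hu
  have hgu : g u = f z := hg.invol _
  have hu0 : w u = false := hg.letter_eq_false hx
  have hne : f u ≠ g u := by
    intro h
    rw [hgu] at h
    have := congrArg f h
    rw [hf.invol, hf.invol] at this
    exact hmem.1.ne' this
  have hopen : f u < u ∨ g u < u → False := fun h => hne (hcl u hu0 h)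
  rw [imp_false, not_or, not_lt, not_lt] at hopen
  have hfu : u < f u := lt_of_le_of_ne hopen.1 (hf.apply_ne u).symm
  have hgu' : u < g u := lt_of_le_of_ne hopen.2 (hg.apply_ne u).symm
  have hin := Finset.mem_Ioo.1
    (hf.apply_mem_Ioo (Finset.mem_Ioo.2 ⟨hmem.1, by rw [← hgu]; exact hgu'⟩))
  have hzu := Fin.lt_def.1 hmem.1
  have := ih (N - u) (by have := u.2; omega) u hu0 (by have := u.2; omega) hfu hgu'
  rw [hgu] at this
  exact absurd hin.2 (not_lt.2 this)

/-- A partner map is determined by the numbers of covered ones. -/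
theorem IsPartnerMap.eq_of_card_coveredOnes_eq (hρ : IsRunIndex w ρ) (hf : IsPartnerMap w f)
    (hg : IsPartnerMap w g) {r : ℕ} (hr : ∀ k, ρ k < r)
    (hcard : ∀ j < r, (coveredOnes w ρ f j).card = (coveredOnes w ρ g j).card) : f = g := by
  have hcl : ∀ d, w d = false → (f d < d ∨ g d < d) → f d = g d :=
    fun d h1 h2 => closers_agree hρ hf hg hr hcard _ d h1 rfl h2
  have hzero : ∀ z, w z = false → f z = g z := by
    intro z hz
    by_cases h : f z < z ∨ g z < z
    · exact hcl z hz h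
    · push Not at h
      have h1 := lt_of_le_of_ne h.1 (hf.apply_ne z).symm
      have h2 := lt_of_le_of_ne h.2 (hg.apply_ne z).symm
      have ht : (z : ℕ) + (N - z) = N := by have := z.2; omega
      exact le_antisymm
        (opener_apply_le hg hf (fun d h1 h2 => (hcl d h1 h2.symm).symm) _ z hz ht h2 h1)
        (opener_apply_le hf hg hcl _ z hz ht h1 h2)
  funext k
  cases hk : w k
  · exact hzero k hk
  · have h := hzero (f k) (hf.letter_eq_false hk)
    rw [hf.invol] at h
    conv_rhs => rw [h]
    exact (hg.invol _).symm

end PartnerMap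

/-- Every non-crossing pairing of a word arises from a partner map. -/
lemma exists_isPartnerMap {w : List Bool} {π : Finset (Finset (Fin w.length))}
    (hπ : IsNCPairingOn w π) :
    ∃ f, IsPartnerMap w.get f ∧ ∀ B, B ∈ π ↔ ∃ i, B = {i, f i} := by
  obtain ⟨⟨hcard, huniq⟩, hnc, hne⟩ := hπ
  have hex : ∀ i, ∃ j, j ≠ i ∧ ({i, j} : Finset (Fin w.length)) ∈ π := by
    intro i
    obtain ⟨B, ⟨hB, hi⟩, -⟩ := huniq i
    obtain ⟨a, b, hab, rfl⟩ := Finset.card_eq_two.1 (hcard B hB)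
    rcases Finset.mem_insert.1 hi with rfl | h
    · exact ⟨b, hab.symm, hB⟩
    · rw [Finset.mem_singleton] at h
      subst h
      exact ⟨a, hab, by rwa [Finset.pair_comm]⟩
  choose f hf1 hf2 using hex
  have hblock : ∀ B ∈ π, ∀ i ∈ B, B = {i, f i} := fun B hB i hi =>
    (huniq i).unique ⟨hB, hi⟩ ⟨hf2 i, by simp⟩
  refine ⟨f, ⟨?_, ?_, ?_⟩, ?_⟩
  · intro k
    have h := hblock _ (hf2 k) (f k) (by simp)
    have hk : k ∈ ({f k, f (f k)} : Finset (Fin w.length)) := by rw [← h]; simp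
    rcases Finset.mem_insert.1 hk with h' | h'
    · exact absurd h'.symm (hf1 k)
    · exact (Finset.mem_singleton.1 h').symm
  · intro k
    exact hne _ (hf2 k) _ (by simp) _ (by simp) (hf1 k)
  · intro i j h1 h2 h3
    exact hnc ⟨_, hf2 i, _, hf2 j, i, f i, j, f j, by simp, by simp, by simp, by simp, h1, h2, h3⟩
  · intro B
    constructor
    · intro hB
      obtain ⟨a, b, -, rfl⟩ := Finset.card_eq_two.1 (hcard B hB)
      exact ⟨a, hblock _ hB a (by simp)⟩
    · rintro ⟨i, rfl⟩
      exact hf2 i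

lemma prefSum_succ {r : ℕ} (f : Fin r → ℕ) {j : ℕ} (hj : j < r) :
    prefSum f (j + 1) = prefSum f j + f ⟨j, hj⟩ := by
  have h : Finset.univ.filter (fun i : Fin r => (i : ℕ) < j + 1) =
      insert ⟨j, hj⟩ (Finset.univ.filter fun i : Fin r => (i : ℕ) < j) := by
    ext i
    simp only [Finset.mem_filter, Finset.mem_univ, true_and, Finset.mem_insert, Fin.ext_iff]
    omega
  rw [prefSum, h, Finset.sum_insert (by simp), add_comm, prefSum]

lemma prefSum_zero {r : ℕ} (f : Fin r → ℕ) : prefSum f 0 = 0 := by simp [prefSum]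

lemma prefSum_self {r : ℕ} (f : Fin r → ℕ) : prefSum f r = ∑ i, f i := by simp [prefSum]

lemma prefSum_mono {r : ℕ} (f : Fin r → ℕ) : Monotone (prefSum f) := by
  intro i j hij
  refine Finset.sum_le_sum_of_subset fun k hk => ?_
  simp only [Finset.mem_filter, Finset.mem_univ, true_and] at hk ⊢
  omega

/-- Partial sums of consecutive differences telescope. -/
lemma prefSum_sub {r : ℕ} {M : ℕ → ℕ} (hM : Monotone M) (h0 : M 0 = 0) {j : ℕ} (hj : j ≤ r) :
    prefSum (fun i : Fin r => M (i + 1) - M i) j = M j := by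
  induction j with
  | zero => rw [prefSum_zero, h0]
  | succ j ih =>
    rw [prefSum_succ _ hj, ih (by omega)]
    have := hM (Nat.le_succ j)
    simp only [Nat.succ_eq_add_one] at this ⊢
    omega

lemma finite_setOf_inCF {r : ℕ} (n : Fin r → ℕ) : {m | InCF n m}.Finite := by
  refine (Set.finite_Iic (fun _ => ∑ i, n i)).subset fun m hm i => ?_
  rw [← hm.2]
  exact Finset.single_le_sum (f := m) (fun _ _ => Nat.zero_le _) (Finset.mem_univ i)

/-- A word whose runs have at most the partial sums of `n'` as numbers of ones has at most
`|CF(n')|` non-crossing pairings. -/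
theorem phi_le_card_inCF {w : List Bool} {ρ : Fin w.length → ℕ} (hρ : IsRunIndex w.get ρ)
    {r : ℕ} (hr : ∀ k, ρ k < r) (n' : Fin r → ℕ)
    (hn' : ∀ j ≤ r, (Finset.univ.filter fun x => w.get x = true ∧ ρ x < j).card ≤ prefSum n' j) :
    phi w ≤ Nat.card {m' | InCF n' m'} := by
  classical
  choose F hF hFmem using fun π : {π // IsNCPairingOn w π} => exists_isPartnerMap π.2
  let M : {π // IsNCPairingOn w π} → ℕ → ℕ := fun π j =>
    if j < r then (coveredOnes w.get ρ (F π) j).card else prefSum n' r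
  have hbound : ∀ π, ∀ j ≤ r, (coveredOnes w.get ρ (F π) j).card ≤ prefSum n' j :=
    fun π j hj => (Finset.card_le_card (coveredOnes_subset hρ j)).trans (hn' j hj)
  have hMmono : ∀ π, Monotone (M π) := by
    intro π i j hij
    simp only [M]
    split_ifs with h1 h2 <;> try omega
    · exact Finset.card_le_card (coveredOnes_mono _ _ _ hij)
    · exact (hbound π i h1.le).trans (prefSum_mono n' h1.le)
  have hM0 : ∀ π, M π 0 = 0 := by
    intro π
    simp only [M]
    split_ifs
    · rw [coveredOnes_zero, Finset.card_empty]
    · obtain rfl : r = 0 := by omega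
      rw [prefSum_zero]
  have hsum : ∀ π, ∀ j ≤ r, prefSum (fun i : Fin r => M π (i + 1) - M π i) j = M π j :=
    fun π j hj => prefSum_sub (hMmono π) (hM0 π) hj
  have hmem : ∀ π, InCF n' fun i : Fin r => M π (i + 1) - M π i := by
    intro π
    constructor
    · intro j h1 h2
      rw [hsum π j (by omega)]
      simp only [M, if_pos (show j < r by omega)]
      exact hbound π j (by omega)
    · rw [← prefSum_self, hsum π r le_rfl, ← prefSum_self n']
      simp [M]
  have hfin : Finite {m' | InCF n' m'} := finite_setOf_inCF n'
  refine Nat.card_le_card_of_injective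
    (fun π : {π // IsNCPairingOn w π} => (⟨_, hmem π⟩ : {m' | InCF n' m'})) ?_
  intro π π' h
  have h := Subtype.ext_iff.1 h
  have hFeq : F π = F π' := by
    refine (hF π).eq_of_card_coveredOnes_eq hρ (hF π') hr fun j hj => ?_
    have h1 := hsum π j hj.le
    have h2 := hsum π' j hj.le
    simp only at h
    rw [h] at h1
    have h3 := h1.symm.trans h2
    simpa only [M, if_pos hj] using h3
  apply Subtype.ext
  ext B
  rw [hFmem π, hFmem π', hFeq]

/-- The letters of `runsF n m`, each labelled by its run. -/
def labelledRuns {r : ℕ} (n m : Fin r → ℕ) : List (Fin r × Bool) :=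
  (List.finRange r).flatMap fun i =>
    List.replicate (n i) (i, true) ++ List.replicate (m i) (i, false)

lemma map_snd_labelledRuns {r : ℕ} (n m : Fin r → ℕ) :
    (labelledRuns n m).map Prod.snd = runsF n m := by
  simp [labelledRuns, runsF, List.map_flatMap]

lemma pairwise_labelledRuns {r : ℕ} (n m : Fin r → ℕ) :
    (labelledRuns n m).Pairwise
      fun p q => p.1 ≤ q.1 ∧ (p.1 = q.1 → q.2 = true → p.2 = true) := by
  rw [labelledRuns, List.pairwise_flatMap]
  constructor
  · intro i _
    rw [List.pairwise_append]
    refine ⟨?_, ?_, ?_⟩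
    · simp [List.pairwise_replicate]
    · simp [List.pairwise_replicate]
    · intro a ha b hb
      rw [List.eq_of_mem_replicate ha, List.eq_of_mem_replicate hb]
      simp
  · refine (List.pairwise_lt_finRange r).imp ?_
    intro i j hij x hx y hy
    have hx1 : x.1 = i := by
      rcases List.mem_append.1 hx with h | h <;> rw [List.eq_of_mem_replicate h]
    have hy1 : y.1 = j := by
      rcases List.mem_append.1 hy with h | h <;> rw [List.eq_of_mem_replicate h]
    rw [hx1, hy1]
    exact ⟨hij.le, fun h => absurd h hij.ne⟩

lemma countP_labelledRuns {r : ℕ} (n m : Fin r → ℕ) (j : ℕ) :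
    (labelledRuns n m).countP (fun p => p.2 && decide ((p.1 : ℕ) < j)) = prefSum n j := by
  rw [labelledRuns, List.countP_flatMap, prefSum, Finset.sum_filter]
  rw [← List.sum_ofFn, List.ofFn_eq_map]
  congr 1
  refine List.map_congr_left fun i _ => ?_
  by_cases h : (i : ℕ) < j <;> simp [List.countP_replicate, h]

lemma countP_eq_card_filter_get {α : Type*} (p : α → Bool) (L : List α) :
    L.countP p = (Finset.univ.filter fun k : Fin L.length => p (L.get k) = true).card := by
  rw [Finset.card_filter]
  induction L with
  | nil => simp
  | cons a L ih =>
    rw [List.countP_cons, ih]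
    simp only [List.length_cons, Fin.sum_univ_succ]
    simp [add_comm]
    rfl

/-- `φ(1^{n₁}0^{m₁}⋯1^{n_r}0^{m_r}) ≤ |CF(n')|` when the partial sums of `n'` are at least those of `n`. -/
theorem phi_runsF_le {r : ℕ} (n m n' : Fin r → ℕ)
    (hdom : ∀ j ≤ r, prefSum n j ≤ prefSum n' j) :
    phi (runsF n m) ≤ Nat.card {m' | InCF n' m'} := by
  rw [← map_snd_labelledRuns]
  set L := labelledRuns n m with hL
  have hpw := List.pairwise_iff_getElem.1 (pairwise_labelledRuns n m)
  rw [← hL] at hpw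
  have hlen : (L.map Prod.snd).length = L.length := List.length_map _
  refine phi_le_card_inCF
    (ρ := fun k => ((L.get (k.cast hlen)).1 : ℕ)) ⟨?_, ?_⟩ (fun k => Fin.is_lt _) n' ?_
  · intro i k hik
    rcases hik.eq_or_lt with rfl | h
    · exact le_rfl
    · exact (hpw i k (hlen ▸ i.2) (hlen ▸ k.2) h).1
  · intro i k hik hρ hk
    rcases hik.eq_or_lt with rfl | h
    · exact hk
    · have := (hpw i k (hlen ▸ i.2) (hlen ▸ k.2) h).2 (Fin.ext hρ)
      simp only [List.get_eq_getElem, List.getElem_map] at hk ⊢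
      exact this hk
  · intro j hj
    refine le_trans (le_of_eq ?_) (hdom j hj)
    rw [← countP_labelledRuns n m j, ← hL]
    rw [countP_eq_card_filter_get]
    refine Finset.card_equiv (finCongr hlen) fun k => ?_
    simp

/-- If `n'` dominates `n` and `w(n,m)` is balanced, then there
is a cyclic rotation of `n'` with `φ(1^{n₁}0^{m₁}⋯1^{n_r}0^{m_r}) ≤ |CF(Rot(n'))|`. -/
theorem stmt19 (r : ℕ) (hr : 1 ≤ r) (n m n' : Fin r → ℕ)
    (hn : ∀ i, 1 ≤ n i) (hm : ∀ i, 1 ≤ m i) (hn' : ∀ i, 1 ≤ n' i)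
    (hbal : ∑ i, n i = ∑ i, m i)
    (hdom : ∀ j : ℕ, 1 ≤ j → j ≤ r → prefSum n j ≤ prefSum n' j) :
    ∃ c : Fin r,
      phi (runsF n m) ≤ Nat.card {m' : Fin r → ℕ | InCF (fun j => n' (j + c)) m'} := by
  refine ⟨⟨0, hr⟩, ?_⟩
  have hrot : (fun j => n' (j + ⟨0, hr⟩)) = n' := by
    funext j
    congr 1
    ext
    simp [Fin.val_add, Nat.mod_eq_of_lt j.2]
  rw [hrot]
  refine phi_runsF_le n m n' fun j hj => ?_
  rcases Nat.eq_zero_or_pos j with rfl | h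
  · rw [prefSum_zero, prefSum_zero]
  · exact hdom j h hj
end
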